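/- For every ε ∈ (0, 1) there exists a constant C = C(ε) > 0 such that for every f ∈ 𝓢(ℝ²), ‖U(t)f‖_{L⁴_x L^∞_{y,t}} ≤ C ‖⟨D⟩^(3/4+ε) f‖_{L²(ℝ²)}, where ‖F‖_{L⁴_x L^∞_{y,t}} = ( ∫_ℝ ( sup_{(y,t) ∈ ℝ²} |F(x, y, t)| )⁴ dx )^(1/4) and ⟨D⟩^α is the Fourier multiplier with symbol (1 + |ζ|²)^(α/2). -/

import Mathlib

open MeasureTheory

/-- Fourier transform on ℝ² with the convention `f̂(ξ,η) = ∫ f(x,y) e^{−i(xξ+yη)} dx dy`. -/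
noncomputable def FT (f : ℝ × ℝ → ℂ) (ζ : ℝ × ℝ) : ℂ :=
  ∫ p : ℝ × ℝ, f p * Complex.exp (-Complex.I * ((p.1 * ζ.1 + p.2 * ζ.2 : ℝ) : ℂ))

/-- The free evolution of the linear symmetrized mZK equation:
`(U(t)f)(x,y) = (2π)^{-2} ∫ e^{i(xξ+yη+t(ξ³+η³))} f̂(ζ) dζ`. -/
noncomputable def freeU (f : ℝ × ℝ → ℂ) (x y t : ℝ) : ℂ :=
  ((((2 * Real.pi) ^ 2)⁻¹ : ℝ) : ℂ) *
    ∫ ζ : ℝ × ℝ,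
      Complex.exp (Complex.I * ((x * ζ.1 + y * ζ.2 + t * (ζ.1 ^ 3 + ζ.2 ^ 3) : ℝ) : ℂ)) *
      FT f ζ

/-- The Bessel-type Fourier multiplier `⟨D⟩^α` of symbol `(1+|ζ|²)^{α/2}` applied to `f`:
`(⟨D⟩^α f)(x,y) = (2π)^{-2} ∫ (1+|ζ|²)^{α/2} e^{i(xξ+yη)} f̂(ζ) dζ`. -/
noncomputable def JD (α : ℝ) (f : ℝ × ℝ → ℂ) (x y : ℝ) : ℂ :=
  ((((2 * Real.pi) ^ 2)⁻¹ : ℝ) : ℂ) *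
    ∫ ζ : ℝ × ℝ, (((1 + ‖ζ‖ ^ 2) ^ (α / 2) : ℝ) : ℂ) *
      Complex.exp (Complex.I * ((x * ζ.1 + y * ζ.2 : ℝ) : ℂ)) *
      FT f ζ

open FourierTransform SchwartzMap

section
variable {E : Type*} [NormedAddCommGroup E] [InnerProductSpace ℝ E] [FiniteDimensional ℝ E]
  [MeasurableSpace E] [BorelSpace E]

theorem fourier_toLp_ae_eq {g : E → ℂ} (h1 : Integrable g) (h2 : MemLp g 2) :
    (𝓕 (h2.toLp g) : Lp ℂ 2 (volume : Measure E)) =ᵐ[volume] 𝓕 g := by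
  have hcont : Continuous (𝓕 g) :=
    VectorFourier.fourierIntegral_continuous Real.continuous_fourierChar continuous_inner h1
  refine ae_eq_of_integral_contDiff_smul_eq
    ((Lp.memLp _).locallyIntegrable (by norm_num)) hcont.locallyIntegrable ?_
  intro φ hφ hsupp
  have hφc : ContDiff ℝ (⊤ : ℕ∞) (fun x => (φ x : ℂ)) := Complex.ofRealCLM.contDiff.comp hφ
  have hsc : HasCompactSupport (fun x => (φ x : ℂ)) := hsupp.comp_left (g := Complex.ofReal) (by simp)
  let Φ : 𝓢(E, ℂ) := hsc.toSchwartzMap hφc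
  have hΦ : ∀ x, Φ x = φ x := fun x => rfl
  have e1 := congrArg (fun T => T Φ) (Lp.fourier_toTemperedDistribution_eq (h2.toLp g))
  simp only [TemperedDistribution.fourier_apply, Lp.toTemperedDistribution_apply, hΦ] at e1
  have e2 : ∫ x, φ x • 𝓕 g x = ∫ x, (𝓕 Φ) x • g x := by
    have := VectorFourier.integral_fourierIntegral_smul_eq_flip (L := innerₗ E)
      Real.continuous_fourierChar continuous_inner Φ.integrable h1 (μ := volume) (ν := volume)
    rw [flip_innerₗ] at this
    exact this.symm
  rw [e2]
  simp only [Complex.real_smul]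
  simp only [smul_eq_mul] at e1 ⊢
  rw [← e1]
  refine integral_congr_ae ?_
  filter_upwards [h2.coeFn_toLp] with x hx
  rw [hx]

theorem memLp_two_fourier {g : E → ℂ} (h1 : Integrable g) (h2 : MemLp g 2) :
    MemLp (𝓕 g) 2 ∧ ∫ x, ‖𝓕 g x‖ ^ 2 = ∫ x, ‖g x‖ ^ 2 := by
  have hae := fourier_toLp_ae_eq h1 h2
  have hm : MemLp (𝓕 g) 2 := (memLp_congr_ae hae).1 (Lp.memLp _)
  refine ⟨hm, ?_⟩
  have key := Lp.norm_fourier_eq (h2.toLp g)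
  rw [Lp.norm_def, Lp.norm_toLp, eLpNorm_congr_ae hae] at key
  have h := fun (u : E → ℂ) (hu : MemLp u 2) => hu.eLpNorm_eq_integral_rpow_norm (by norm_num) (by norm_num)
  rw [h _ hm, h _ h2] at key
  have hnn := fun u : E → ℂ => integral_nonneg (μ := volume) (f := fun x => ‖u x‖ ^ 2) (fun x => by positivity)
  simp only [ENNReal.toReal_ofNat, Real.rpow_ofNat] at key
  rw [ENNReal.toReal_ofReal (by have := hnn (𝓕 g); positivity), ENNReal.toReal_ofReal (by have := hnn g; positivity)] at key
  exact (Real.rpow_left_inj (hnn _) (hnn _) (by norm_num)).1 key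
end

theorem fourier_complex_apply (g : ℝ × ℝ → ℂ) (w : ℂ) :
    𝓕 (fun v : ℂ => g (v.re, v.im)) w =
      ∫ ζ : ℝ × ℝ, Complex.exp (-(2 * Real.pi * (ζ.1 * w.re + ζ.2 * w.im) : ℝ) * Complex.I) * g ζ := by
  rw [← Complex.volume_preserving_equiv_real_prod.integral_comp
    Complex.measurableEquivRealProd.measurableEmbedding, Real.fourier_eq']
  refine integral_congr_ae (Filter.Eventually.of_forall fun v => ?_)
  simp only [Complex.inner, Complex.measurableEquivRealProd_apply, smul_eq_mul]
  congr 3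
  simp
  ring

theorem integral_norm_sq_fourier_real_prod {g : ℝ × ℝ → ℂ} (h1 : Integrable g) (h2 : MemLp g 2) :
    ∫ p : ℝ × ℝ, ‖∫ ζ : ℝ × ℝ,
      Complex.exp (Complex.I * ((p.1 * ζ.1 + p.2 * ζ.2 : ℝ) : ℂ)) * g ζ‖ ^ 2 =
      (2 * Real.pi) ^ 2 * ∫ ζ, ‖g ζ‖ ^ 2 := by
  have mp := Complex.volume_preserving_equiv_real_prod
  have emb := Complex.measurableEquivRealProd.measurableEmbedding
  have h1' : Integrable (fun v : ℂ => g (v.re, v.im)) := mp.integrable_comp_of_integrable h1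
  have h2' : MemLp (fun v : ℂ => g (v.re, v.im)) 2 := h2.comp_measurePreserving mp
  have key := (memLp_two_fourier h1' h2').2
  have e1 : ∫ v : ℂ, ‖g (v.re, v.im)‖ ^ 2 = ∫ ζ, ‖g ζ‖ ^ 2 :=
    mp.integral_comp emb (fun ζ => ‖g ζ‖ ^ 2)
  rw [e1] at key
  rw [← key, ← mp.integral_comp emb]
  have hs := Measure.integral_comp_smul (volume : Measure ℂ)
    (fun w => ‖𝓕 (fun v : ℂ => g (v.re, v.im)) w‖ ^ 2) (-(2 * Real.pi)⁻¹)
  have hpi : (0:ℝ) < 2 * Real.pi := by positivity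
  have e2 : |((-(2 * Real.pi)⁻¹) ^ Module.finrank ℝ ℂ)⁻¹| = (2 * Real.pi) ^ 2 := by
    rw [Complex.finrank_real_complex]
    rw [neg_sq, inv_pow, inv_inv, abs_of_pos (by positivity)]
  rw [e2, smul_eq_mul] at hs
  rw [← hs]
  refine integral_congr_ae (Filter.Eventually.of_forall fun v => ?_)
  simp only [fourier_complex_apply, Complex.measurableEquivRealProd_apply]
  congr 2
  refine integral_congr_ae (Filter.Eventually.of_forall fun ζ => ?_)
  simp only
  congr 2
  simp
  field_simp
  ring

theorem exists_schwartz_eq_FT (f : SchwartzMap (ℝ × ℝ) ℂ) :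
    ∃ G : SchwartzMap (ℝ × ℝ) ℂ, FT f = G := by
  let F : 𝓢(ℂ, ℂ) := 𝓕 (SchwartzMap.compCLMOfContinuousLinearEquiv ℂ Complex.equivRealProdCLM f)
  let e : (ℝ × ℝ) ≃L[ℝ] ℂ := Complex.equivRealProdCLM.symm.trans
    (ContinuousLinearEquiv.smulLeft (Units.mk0 ((2 * Real.pi)⁻¹ : ℝ) (by positivity)))
  refine ⟨SchwartzMap.compCLMOfContinuousLinearEquiv ℂ e F, ?_⟩
  ext ζ
  have he : e ζ = ((2 * Real.pi)⁻¹ : ℝ) • (⟨ζ.1, ζ.2⟩ : ℂ) := rfl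
  have hF : ∀ w, F w = 𝓕 (fun v : ℂ => f (v.re, v.im)) w := fun w => rfl
  rw [SchwartzMap.compCLMOfContinuousLinearEquiv_apply, Function.comp_apply, hF, he,
    fourier_complex_apply, FT]
  refine integral_congr_ae (Filter.Eventually.of_forall fun p => ?_)
  simp only
  rw [mul_comm]
  congr 2
  simp
  field_simp

theorem SchwartzMap.integrable_memLp_two_rpow_mul (G : SchwartzMap (ℝ × ℝ) ℂ) (β : ℝ) :
    Integrable (fun ζ : ℝ × ℝ => (((1 + ‖ζ‖ ^ 2) ^ β : ℝ) : ℂ) * G ζ) ∧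
      MemLp (fun ζ : ℝ × ℝ => (((1 + ‖ζ‖ ^ 2) ^ β : ℝ) : ℂ) * G ζ) 2 := by
  have hc : Continuous (fun ζ : ℝ × ℝ => (((1 + ‖ζ‖ ^ 2) ^ β : ℝ) : ℂ) * G ζ) := by
    refine (Complex.continuous_ofReal.comp ?_).mul G.continuous
    exact Continuous.rpow_const (by fun_prop) (fun x => Or.inl (by positivity))
  obtain ⟨n, hn⟩ := exists_nat_ge β
  set C := 2 ^ (2 * n + 3) * (Finset.Iic (2 * n + 3, 0)).sup
    (fun m => SchwartzMap.seminorm ℝ m.1 m.2) G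
  have hb : ∀ ζ : ℝ × ℝ, ‖(((1 + ‖ζ‖ ^ 2) ^ β : ℝ) : ℂ) * G ζ‖ ≤ C * (1 + ‖ζ‖) ^ (-3 : ℝ) := by
    intro ζ
    have h := SchwartzMap.one_add_le_sup_seminorm_apply (𝕜 := ℝ) (m := (2 * n + 3, 0))
      le_rfl le_rfl G ζ
    rw [norm_iteratedFDeriv_zero] at h
    have h0 : 0 < 1 + ‖ζ‖ := by positivity
    rw [norm_mul, Complex.norm_real, Real.norm_of_nonneg (by positivity), Real.rpow_neg h0.le,
      ← div_eq_mul_inv, le_div_iff₀ (by positivity)]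
    refine le_trans ?_ h
    have h1 : (1 + ‖ζ‖ ^ 2) ^ β ≤ (1 + ‖ζ‖) ^ (2 * n) := by
      calc (1 + ‖ζ‖ ^ 2) ^ β ≤ (1 + ‖ζ‖ ^ 2) ^ (n : ℝ) :=
            Real.rpow_le_rpow_of_exponent_le (by nlinarith [sq_nonneg ‖ζ‖]) hn
        _ = (1 + ‖ζ‖ ^ 2) ^ n := Real.rpow_natCast _ _
        _ ≤ ((1 + ‖ζ‖) ^ 2) ^ n := by gcongr; nlinarith [norm_nonneg ζ]
        _ = _ := by rw [← pow_mul]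
    have h3 : (1 + ‖ζ‖) ^ (3 : ℝ) = (1 + ‖ζ‖) ^ 3 := Real.rpow_natCast _ 3
    rw [h3, pow_add]
    calc (1 + ‖ζ‖ ^ 2) ^ β * ‖G ζ‖ * (1 + ‖ζ‖) ^ 3
        ≤ (1 + ‖ζ‖) ^ (2 * n) * ‖G ζ‖ * (1 + ‖ζ‖) ^ 3 := by gcongr
      _ = _ := by ring
  have hInt : Integrable (fun ζ : ℝ × ℝ => (1 + ‖ζ‖) ^ (-3 : ℝ)) :=
    integrable_one_add_norm (by simp; norm_num)
  have hC : 0 ≤ C := by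
    have := (norm_nonneg _).trans (hb 0)
    simpa using this
  refine ⟨(hInt.const_mul C).mono' hc.aestronglyMeasurable (Filter.Eventually.of_forall hb), ?_⟩
  rw [memLp_two_iff_integrable_sq_norm hc.aestronglyMeasurable]
  refine (hInt.const_mul (C * C)).mono' (hc.norm.pow 2).aestronglyMeasurable
    (Filter.Eventually.of_forall fun ζ => ?_)
  rw [Real.norm_of_nonneg (by positivity), sq, mul_assoc]
  have h1 : (1 + ‖ζ‖) ^ (-3 : ℝ) ≤ 1 :=
    Real.rpow_le_one_of_one_le_of_nonpos (by linarith [norm_nonneg ζ]) (by norm_num)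
  calc _ ≤ (C * (1 + ‖ζ‖) ^ (-3 : ℝ)) * (C * (1 + ‖ζ‖) ^ (-3 : ℝ)) :=
        mul_le_mul (hb ζ) (hb ζ) (norm_nonneg _) (by positivity)
    _ ≤ (C * 1) * (C * (1 + ‖ζ‖) ^ (-3 : ℝ)) := by gcongr
    _ = _ := by ring

theorem integral_norm_sq_JD (f : SchwartzMap (ℝ × ℝ) ℂ) (α : ℝ) :
    Integrable (fun ζ : ℝ × ℝ => (1 + ‖ζ‖ ^ 2) ^ α * ‖FT f ζ‖ ^ 2) ∧
    ∫ p : ℝ × ℝ, ‖JD α f p.1 p.2‖ ^ 2 =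
      ((2 * Real.pi) ^ 2)⁻¹ * ∫ ζ : ℝ × ℝ, (1 + ‖ζ‖ ^ 2) ^ α * ‖FT f ζ‖ ^ 2 := by
  obtain ⟨G, hG⟩ := exists_schwartz_eq_FT f
  obtain ⟨m1, m2⟩ := G.integrable_memLp_two_rpow_mul (α / 2)
  have key := integral_norm_sq_fourier_real_prod m1 m2
  have e : (fun ζ : ℝ × ℝ => ‖(((1 + ‖ζ‖ ^ 2) ^ (α / 2) : ℝ) : ℂ) * G ζ‖ ^ 2) =
      fun ζ : ℝ × ℝ => (1 + ‖ζ‖ ^ 2) ^ α * ‖FT f ζ‖ ^ 2 := by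
    ext ζ
    rw [norm_mul, mul_pow, hG, Complex.norm_real, Real.norm_of_nonneg (by positivity),
      ← Real.rpow_mul_natCast (by positivity)]
    congr 2
    push_cast; ring
  have hi := m2.integrable_norm_pow (by norm_num)
  simp only at hi
  rw [← e]
  refine ⟨hi, ?_⟩
  simp only [JD, norm_mul, mul_pow, integral_const_mul]
  have e3 : ∀ p : ℝ × ℝ, (∫ ζ : ℝ × ℝ, (((1 + ‖ζ‖ ^ 2) ^ (α / 2) : ℝ) : ℂ) *
      Complex.exp (Complex.I * ((p.1 * ζ.1 + p.2 * ζ.2 : ℝ) : ℂ)) * FT f ζ) =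
      ∫ ζ : ℝ × ℝ, Complex.exp (Complex.I * ((p.1 * ζ.1 + p.2 * ζ.2 : ℝ) : ℂ)) *
       ((((1 + ‖ζ‖ ^ 2) ^ (α / 2) : ℝ) : ℂ) * G ζ) := by
    intro p
    congr 1
    ext ζ
    rw [hG]; ring
  simp only [e3]
  rw [key, Complex.norm_real, Real.norm_of_nonneg (by positivity)]
  simp only [norm_mul, mul_pow]
  field_simp

theorem exists_inv_one_add_sq_phase_deriv_le (s : ℝ) :
    ∃ c : ℝ, ∀ u : ℝ, 0 ≤ u →
      (1 + (2 * u + 6 * s * u ^ 5) ^ 2)⁻¹ ≤ (1 + u ^ 2)⁻¹ + (1 + (u - c) ^ 2)⁻¹ := by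
  have hpos : ∀ v : ℝ, 0 ≤ (1 + v ^ 2)⁻¹ := fun v => by positivity
  rcases le_or_gt 0 s with hs | hs
  · refine ⟨0, fun u hu => ?_⟩
    have h5 : 0 ≤ 6 * s * u ^ 5 := by positivity
    have : (1 + (2 * u + 6 * s * u ^ 5) ^ 2)⁻¹ ≤ (1 + u ^ 2)⁻¹ := by
      gcongr; linarith
    linarith [hpos (u - 0)]
  · set c : ℝ := ((-(3 * s))⁻¹) ^ ((4 : ℝ)⁻¹) with hc
    have hb : 0 < (-(3 * s))⁻¹ := inv_pos.2 (by linarith)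
    have hc0 : 0 < c := Real.rpow_pos_of_pos hb _
    have hc4 : c ^ 4 = (-(3 * s))⁻¹ := by
      rw [hc, ← Real.rpow_natCast, ← Real.rpow_mul hb.le]; norm_num
    have hs' : s = -(1 / (3 * c ^ 4)) := by
      rw [hc4]; field_simp
    refine ⟨c, fun u hu => ?_⟩
    obtain ⟨v, hv, rfl⟩ : ∃ v, 0 ≤ v ∧ u = c * v := ⟨u / c, by positivity, by field_simp⟩
    have hp : 2 * (c * v) + 6 * s * (c * v) ^ 5 = 2 * (c * v) * (1 - v ^ 4) := by
      rw [hs']; field_simp; ring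
    rw [hp]
    rcases le_total v (1 / 2) with h | h
    · have hv4 : v ^ 4 ≤ 1 / 2 := by
        calc v ^ 4 ≤ (1 / 2) ^ 4 := by gcongr
          _ ≤ _ := by norm_num
      have : (1 + (2 * (c * v) * (1 - v ^ 4)) ^ 2)⁻¹ ≤ (1 + (c * v) ^ 2)⁻¹ := by
        have hle : c * v ≤ 2 * (c * v) * (1 - v ^ 4) := by nlinarith [mul_nonneg hc0.le hv]
        exact inv_anti₀ (by positivity) (by linarith [pow_le_pow_left₀ hu hle 2])
      linarith [hpos (c * v - c)]
    · have : (1 + (2 * (c * v) * (1 - v ^ 4)) ^ 2)⁻¹ ≤ (1 + (c * v - c) ^ 2)⁻¹ := by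
        have hw : 1 ≤ 2 * v * ((1 + v) * (1 + v ^ 2)) := by nlinarith [pow_nonneg hv 3, pow_nonneg hv 2]
        have e : (2 * (c * v) * (1 - v ^ 4)) ^ 2 =
            (2 * v * ((1 + v) * (1 + v ^ 2))) ^ 2 * (c * v - c) ^ 2 := by ring
        rw [e]
        gcongr
        have := one_le_pow₀ hw (n := 2)
        nlinarith [sq_nonneg (c * v - c)]
      linarith [hpos (c * v)]

theorem integral_inv_one_add_sub_sq_le (c A : ℝ) :
    ∫ u in (0 : ℝ)..A, (1 + (u - c) ^ 2)⁻¹ ≤ Real.pi := by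
  rw [intervalIntegral.integral_comp_sub_right (fun u => (1 + u ^ 2)⁻¹), integral_inv_one_add_sq]
  linarith [Real.arctan_lt_pi_div_two (A - c), Real.neg_pi_div_two_lt_arctan (0 - c)]

theorem norm_integral_exp_sq_add_le (s : ℝ) {A : ℝ} (hA : 0 ≤ A) :
    ‖∫ u in (0 : ℝ)..A, Complex.exp (Complex.I * ((u ^ 2 + s * u ^ 6 : ℝ) : ℂ))‖ ≤
      1 + 11 * Real.pi := by
  set p : ℝ → ℝ := fun u => 2 * u + 6 * s * u ^ 5 with hp
  set p' : ℝ → ℝ := fun u => 2 + 30 * s * u ^ 4 with hp'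
  have hpd : ∀ u, HasDerivAt p (p' u) u := by
    intro u
    have := ((hasDerivAt_id u).const_mul 2).add (((hasDerivAt_id u).pow 5).const_mul (6 * s))
    refine this.congr_deriv ?_
    simp [hp']; ring
  have hpc : Continuous p := by fun_prop
  have hpc' : Continuous p' := by fun_prop
  have hden : ∀ u, 1 + p u ^ 2 ≠ 0 := fun u => by positivity
  have hinvc : Continuous fun u => (1 + p u ^ 2)⁻¹ := by fun_prop (disch := exact hden _)
  set ψ : ℝ → ℝ := fun u => p u * (1 + p u ^ 2)⁻¹ with hψ
  set ψ' : ℝ → ℝ := fun u => p' u * (1 - p u ^ 2) * ((1 + p u ^ 2)⁻¹) ^ 2 with hψ'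
  have hψd : ∀ u, HasDerivAt ψ (ψ' u) u := by
    intro u
    have := (hpd u).mul ((((hpd u).pow 2).const_add 1).inv (hden u))
    refine this.congr_deriv ?_
    have := hden u
    simp only [hψ', Pi.inv_apply, Pi.pow_apply, Nat.cast_ofNat]
    field_simp
    ring
  have hψc' : Continuous ψ' := by fun_prop
  set e : ℝ → ℂ := fun u => Complex.exp (Complex.I * ((u ^ 2 + s * u ^ 6 : ℝ) : ℂ)) with he
  have hec : Continuous e := by fun_prop
  have hen : ∀ u, ‖e u‖ = 1 := fun u => by
    simp only [he]; rw [mul_comm, Complex.norm_exp_ofReal_mul_I]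
  have hed : ∀ u, HasDerivAt e (e u * (Complex.I * (p u : ℂ))) u := by
    intro u
    have h1 : HasDerivAt (fun u : ℝ => u ^ 2 + s * u ^ 6) (p u) u := by
      have := ((hasDerivAt_id u).pow 2).add (((hasDerivAt_id u).pow 6).const_mul s)
      refine this.congr_deriv ?_
      simp [hp]; ring
    exact (h1.ofReal_comp.const_mul Complex.I).cexp
  set R : ℝ → ℂ := fun u => e u * (Complex.I * (((1 + p u ^ 2)⁻¹ : ℝ) : ℂ) - (ψ' u : ℂ)) with hR
  have hRc : Continuous R := by fun_prop
  have hftc : ∫ u in (0 : ℝ)..A, (Complex.I * e u - R u) = e A * ψ A - e 0 * ψ 0 := by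
    refine intervalIntegral.integral_eq_sub_of_hasDerivAt (f := fun u => e u * (ψ u : ℂ))
      (fun u _ => ?_) (Continuous.intervalIntegrable (by fun_prop) _ _)
    refine ((hed u).mul (hψd u).ofReal_comp).congr_deriv ?_
    have h2 : (1 + (p u : ℂ) ^ 2) ≠ 0 := by exact_mod_cast hden u
    simp only [hR, hψ]
    push_cast
    field_simp
    ring
  rw [intervalIntegral.integral_sub (Continuous.intervalIntegrable (by fun_prop) _ _)
    (hRc.intervalIntegrable _ _), intervalIntegral.integral_const_mul] at hftc
  have hψb : ∀ u, ‖e u * (ψ u : ℂ)‖ ≤ 1 / 2 := by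
    intro u
    rw [norm_mul, hen, one_mul, Complex.norm_real, Real.norm_eq_abs, hψ]
    simp only [abs_mul]
    rw [abs_of_pos (a := (1 + p u ^ 2)⁻¹) (by positivity), ← div_eq_mul_inv,
      div_le_iff₀ (by positivity)]
    nlinarith [sq_nonneg (|p u| - 1), sq_abs (p u)]
  have hRb : ∀ u, ‖R u‖ ≤ (1 + |p' u|) * (1 + p u ^ 2)⁻¹ := by
    intro u
    rw [hR]
    simp only
    rw [norm_mul, hen, one_mul]
    refine (norm_sub_le _ _).trans ?_
    rw [norm_mul, Complex.norm_I, one_mul, Complex.norm_real, Complex.norm_real,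
      Real.norm_of_nonneg (by positivity), add_mul, one_mul, Real.norm_eq_abs]
    gcongr
    simp only [hψ', abs_mul, abs_pow]
    rw [abs_of_pos (a := (1 + p u ^ 2)⁻¹) (by positivity), mul_assoc]
    gcongr
    have h3 : |1 - p u ^ 2| ≤ 1 + p u ^ 2 := abs_le.2 ⟨by linarith [sq_nonneg (p u)], by linarith [sq_nonneg (p u)]⟩
    calc |1 - p u ^ 2| * (1 + p u ^ 2)⁻¹ ^ 2 ≤ (1 + p u ^ 2) * (1 + p u ^ 2)⁻¹ ^ 2 := by gcongr
      _ = _ := by have := hden u; field_simp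
  have hint1 : ∫ u in (0 : ℝ)..A, (1 + p u ^ 2)⁻¹ ≤ 2 * Real.pi := by
    obtain ⟨c, hc⟩ := exists_inv_one_add_sq_phase_deriv_le s
    have i1 : IntervalIntegrable (fun u : ℝ => (1 + (u - 0) ^ 2)⁻¹) volume 0 A :=
      Continuous.intervalIntegrable (by fun_prop (disch := intro; positivity)) _ _
    have i2 : IntervalIntegrable (fun u : ℝ => (1 + (u - c) ^ 2)⁻¹) volume 0 A :=
      Continuous.intervalIntegrable (by fun_prop (disch := intro; positivity)) _ _
    calc ∫ u in (0 : ℝ)..A, (1 + p u ^ 2)⁻¹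
        ≤ ∫ u in (0 : ℝ)..A, ((1 + (u - 0) ^ 2)⁻¹ + (1 + (u - c) ^ 2)⁻¹) := by
          refine intervalIntegral.integral_mono_on hA (hinvc.intervalIntegrable _ _) (i1.add i2) ?_
          intro u hu
          simpa using hc u hu.1
      _ ≤ _ := by
          rw [intervalIntegral.integral_add i1 i2]
          linarith [integral_inv_one_add_sub_sq_le 0 A, integral_inv_one_add_sub_sq_le c A]
  have hat : ∫ u in (0 : ℝ)..A, p' u * (1 + p u ^ 2)⁻¹ = Real.arctan (p A) - Real.arctan (p 0) := by
    refine intervalIntegral.integral_eq_sub_of_hasDerivAt (f := fun u => Real.arctan (p u))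
      (fun u _ => ?_) (Continuous.intervalIntegrable (by fun_prop) _ _)
    refine (hpd u).arctan.congr_deriv ?_
    rw [one_div, mul_comm]
  have hat2 := And.intro (Real.arctan_lt_pi_div_two (p A)) (Real.neg_pi_div_two_lt_arctan (p A))
  have hp0 : Real.arctan (p 0) = 0 := by simp [hp]
  have hint2 : ∫ u in (0 : ℝ)..A, (1 + |p' u|) * (1 + p u ^ 2)⁻¹ ≤ 11 * Real.pi := by
    obtain ⟨σ, hσ, hle⟩ : ∃ σ : ℝ, (σ = 1 ∨ σ = -1) ∧ ∀ u, |p' u| ≤ 4 + σ * p' u := by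
      rcases le_total 0 s with hs | hs
      · refine ⟨1, Or.inl rfl, fun u => ?_⟩
        have : 0 ≤ p' u := by simp only [hp']; positivity
        rw [abs_of_nonneg this]; linarith
      · refine ⟨-1, Or.inr rfl, fun u => ?_⟩
        have : p' u ≤ 2 := by
          simp only [hp']
          nlinarith [mul_nonneg (neg_nonneg.2 hs) (by positivity : 0 ≤ u ^ 4)]
        rw [abs_le]; constructor <;> linarith
    calc ∫ u in (0 : ℝ)..A, (1 + |p' u|) * (1 + p u ^ 2)⁻¹
        ≤ ∫ u in (0 : ℝ)..A, (5 * (1 + p u ^ 2)⁻¹ + σ * (p' u * (1 + p u ^ 2)⁻¹)) := by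
          refine intervalIntegral.integral_mono_on hA
            (Continuous.intervalIntegrable (by fun_prop) _ _)
            (Continuous.intervalIntegrable (by fun_prop) _ _) (fun u _ => ?_)
          have h4 : 0 ≤ (1 + p u ^ 2)⁻¹ := by positivity
          nlinarith [mul_le_mul_of_nonneg_right (hle u) h4]
      _ = 5 * (∫ u in (0 : ℝ)..A, (1 + p u ^ 2)⁻¹) + σ * Real.arctan (p A) := by
          rw [intervalIntegral.integral_add (Continuous.intervalIntegrable (by fun_prop) _ _)
            (Continuous.intervalIntegrable (by fun_prop) _ _),
            intervalIntegral.integral_const_mul, intervalIntegral.integral_const_mul, hat, hp0,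
            sub_zero]
      _ ≤ _ := by
          rcases hσ with rfl | rfl <;> linarith [hat2.1, hat2.2, Real.pi_pos]
  have hRint : ‖∫ u in (0 : ℝ)..A, R u‖ ≤ 11 * Real.pi :=
    (intervalIntegral.norm_integral_le_of_norm_le hA (Filter.Eventually.of_forall fun u _ => hRb u)
      (Continuous.intervalIntegrable (by fun_prop) _ _)).trans hint2
  have hfin : Complex.I * ∫ u in (0 : ℝ)..A, e u =
      e A * ψ A - e 0 * ψ 0 + ∫ u in (0 : ℝ)..A, R u := by rw [← hftc]; ring
  calc ‖∫ u in (0 : ℝ)..A, e u‖ = ‖Complex.I * ∫ u in (0 : ℝ)..A, e u‖ := by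
        rw [norm_mul, Complex.norm_I, one_mul]
    _ ≤ ‖e A * ψ A - e 0 * ψ 0‖ + ‖∫ u in (0 : ℝ)..A, R u‖ := by rw [hfin]; exact norm_add_le _ _
    _ ≤ (1 / 2 + 1 / 2) + 11 * Real.pi := by
        gcongr
        exact (norm_sub_le _ _).trans (add_le_add (hψb A) (hψb 0))
    _ = _ := by ring

theorem norm_integral_exp_mul_sq_add_le {x : ℝ} (hx : x ≠ 0) (t : ℝ) {A : ℝ} (hA : 0 ≤ A) :
    ‖∫ u in (0 : ℝ)..A, Complex.exp (Complex.I * ((x * u ^ 2 + t * u ^ 6 : ℝ) : ℂ))‖ ≤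
      (1 + 11 * Real.pi) * |x| ^ (-(1 / 2) : ℝ) := by
  wlog h : 0 < x generalizing x t
  · have hneg := this (x := -x) (neg_ne_zero.2 hx) (-t) (by
      rcases lt_or_gt_of_ne hx with h' | h'
      · linarith
      · exact absurd h' h)
    rw [abs_neg] at hneg
    refine le_trans (le_of_eq ?_) hneg
    rw [← RCLike.norm_conj, intervalIntegral.integral_of_le hA,
      intervalIntegral.integral_of_le hA, ← integral_conj]
    congr 2
    ext u
    rw [← Complex.exp_conj, map_mul, Complex.conj_I, Complex.conj_ofReal]
    congr 1
    push_cast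
    ring
  set r : ℝ := Real.sqrt x with hr
  have hr0 : 0 < r := Real.sqrt_pos.2 h
  have hr2 : r ^ 2 = x := Real.sq_sqrt h.le
  have key := norm_integral_exp_sq_add_le (t / r ^ 6) (A := r * A) (by positivity)
  have hsub := intervalIntegral.integral_comp_mul_left (a := 0) (b := A)
    (fun u : ℝ => Complex.exp (Complex.I * ((u ^ 2 + t / r ^ 6 * u ^ 6 : ℝ) : ℂ))) hr0.ne'
  have he : ∀ u : ℝ, (r * u) ^ 2 + t / r ^ 6 * (r * u) ^ 6 = x * u ^ 2 + t * u ^ 6 := by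
    intro u
    rw [← hr2]; field_simp
  simp only [he, mul_zero] at hsub
  rw [hsub, norm_smul, abs_of_pos h, Real.rpow_neg h.le, ← Real.sqrt_eq_rpow, mul_comm,
    Real.norm_of_nonneg (by positivity)]
  gcongr

theorem norm_integral_Ioi_indicator_le {x : ℝ} (hx : x ≠ 0) (t : ℝ) (M : ℝ) :
    ‖∫ ξ in Set.Ioi (0 : ℝ), (if |ξ| ≤ M then |ξ| ^ (-(1 / 2) : ℝ) else 0 : ℝ) *
      Complex.exp (Complex.I * ((x * ξ + t * ξ ^ 3 : ℝ) : ℂ))‖ ≤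
      2 * ((1 + 11 * Real.pi) * |x| ^ (-(1 / 2) : ℝ)) := by
  rw [← integral_comp_rpow_Ioi_of_pos (p := 2) (by norm_num)]
  have e : ∀ u ∈ Set.Ioi (0 : ℝ), (2 * u ^ ((2 : ℝ) - 1)) •
      (((if |u ^ (2 : ℝ)| ≤ M then |u ^ (2 : ℝ)| ^ (-(1 / 2) : ℝ) else 0 : ℝ) : ℂ) *
      Complex.exp (Complex.I * ((x * u ^ (2 : ℝ) + t * (u ^ (2 : ℝ)) ^ 3 : ℝ) : ℂ))) =
      (Set.Iic (Real.sqrt M)).indicator (fun u : ℝ =>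
        2 * Complex.exp (Complex.I * ((x * u ^ 2 + t * u ^ 6 : ℝ) : ℂ))) u := by
    intro u (hu : 0 < u)
    have h2 : u ^ (2 : ℝ) = u ^ 2 := Real.rpow_natCast u 2
    have h1 : u ^ ((2 : ℝ) - 1) = u := by norm_num
    rw [h1, h2, abs_of_pos (by positivity)]
    by_cases hM : u ^ 2 ≤ M
    · have : u ∈ Set.Iic (Real.sqrt M) := Real.le_sqrt_of_sq_le hM
      rw [Set.indicator_of_mem this, if_pos hM]
      have h3 : (u ^ 2) ^ (-(1 / 2) : ℝ) = u⁻¹ := by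
        rw [Real.rpow_neg (by positivity), ← Real.sqrt_eq_rpow, Real.sqrt_sq hu.le]
      rw [h3, Complex.real_smul, ← mul_assoc, ← Complex.ofReal_mul]
      congr 1
      · rw [mul_assoc, mul_inv_cancel₀ hu.ne']; simp
      · ring_nf
    · have : u ∉ Set.Iic (Real.sqrt M) := fun h => hM ((Real.le_sqrt' hu).1 h)
      rw [Set.indicator_of_notMem this, if_neg hM]
      simp
  rw [setIntegral_congr_fun measurableSet_Ioi e, setIntegral_indicator measurableSet_Iic,
    Set.Ioi_inter_Iic, integral_const_mul, ← intervalIntegral.integral_of_le (Real.sqrt_nonneg M),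
    norm_mul]
  have := norm_integral_exp_mul_sq_add_le hx t (Real.sqrt_nonneg M)
  simpa using this

theorem integrable_indicator_abs_rpow (M : ℝ) :
    Integrable (fun ξ : ℝ => (if |ξ| ≤ M then |ξ| ^ (-(1 / 2) : ℝ) else 0 : ℝ)) := by
  have h : LocallyIntegrable (fun ξ : ℝ => |ξ| ^ (-(1 / 2) : ℝ)) := by
    refine locallyIntegrable_of_norm_le_rpow (C := 1) (α := 1 / 2) (by simp) (by simp; norm_num)
      (Filter.Eventually.of_forall fun ξ => ?_)
      (by fun_prop : Measurable _).aestronglyMeasurable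
    rw [one_mul, Real.norm_of_nonneg (by positivity), Real.norm_eq_abs]
  have := (h.integrableOn_isCompact (isCompact_Icc (a := -M) (b := M))).integrable_indicator
    measurableSet_Icc
  refine this.congr (Filter.Eventually.of_forall fun ξ => ?_)
  simp only [Set.indicator_apply, Set.mem_Icc, abs_le]

theorem norm_integral_indicator_abs_rpow_mul_exp_le {x : ℝ} (hx : x ≠ 0) (t : ℝ) (M : ℝ) :
    ‖∫ ξ : ℝ, (if |ξ| ≤ M then |ξ| ^ (-(1 / 2) : ℝ) else 0 : ℝ) *
      Complex.exp (Complex.I * ((x * ξ + t * ξ ^ 3 : ℝ) : ℂ))‖ ≤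
      4 * (1 + 11 * Real.pi) * |x| ^ (-(1 / 2) : ℝ) := by
  set g : ℝ → ℂ := fun ξ => (if |ξ| ≤ M then |ξ| ^ (-(1 / 2) : ℝ) else 0 : ℝ) *
      Complex.exp (Complex.I * ((x * ξ + t * ξ ^ 3 : ℝ) : ℂ)) with hg
  have hi : Integrable g := by
    refine (integrable_indicator_abs_rpow M).ofReal.mul_bdd (c := 1) (by fun_prop)
      (Filter.Eventually.of_forall fun ξ => ?_)
    rw [mul_comm, Complex.norm_exp_ofReal_mul_I]
  have h1 := norm_integral_Ioi_indicator_le hx t M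
  have h2 := norm_integral_Ioi_indicator_le (neg_ne_zero.2 hx) (-t) M
  rw [abs_neg] at h2
  have e2 : ∫ ξ in Set.Ioi (0 : ℝ), (if |ξ| ≤ M then |ξ| ^ (-(1 / 2) : ℝ) else 0 : ℝ) *
      Complex.exp (Complex.I * ((-x * ξ + -t * ξ ^ 3 : ℝ) : ℂ)) = ∫ ξ in Set.Iic (0 : ℝ), g ξ := by
    have := integral_comp_neg_Ioi 0 g
    rw [neg_zero] at this
    rw [← this]
    congr 1
    ext ξ
    simp only [hg, abs_neg]
    congr 3
    push_cast
    ring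
  rw [e2] at h2
  have hsplit := intervalIntegral.integral_Iic_add_Ioi (b := 0) hi.integrableOn hi.integrableOn
  rw [← hsplit]
  refine (norm_add_le _ _).trans ?_
  linarith

theorem integrable_comp_abs {f : ℝ → ℝ} (hf : IntegrableOn f (Set.Ioi 0)) :
    Integrable fun u : ℝ => f |u| := by
  have := (integrable_fun_norm_addHaar (volume : Measure ℝ) (f := f)).2 (by simpa using hf)
  simpa using this

theorem lintegral_ball_abs_rpow_eq {r : ℝ} (hr : 0 < r) :
    ∫⁻ u : ℝ, ENNReal.ofReal (if |u| < r ^ 2 then |u| ^ (-(1 / 2) : ℝ) else 0) =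
      ENNReal.ofReal (4 * r) := by
  set f : ℝ → ℝ := fun u => if u < r ^ 2 then u ^ (-(1 / 2) : ℝ) else 0 with hf
  have hfi : f = (Set.Iio (r ^ 2)).indicator (fun u => u ^ (-(1 / 2) : ℝ)) := by
    ext u; simp [hf, Set.indicator_apply]
  have hr2 : 0 < r ^ 2 := by positivity
  have hInt : IntegrableOn f (Set.Ioi 0) := by
    rw [hfi, integrableOn_indicator_iff measurableSet_Iio, Set.Iio_inter_Ioi,
      intervalIntegral.integrableOn_Ioo_rpow_iff hr2]
    norm_num
  have hInt' : Integrable fun u : ℝ => f |u| := integrable_comp_abs hInt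
  rw [← ofReal_integral_eq_lintegral_ofReal hInt'
    (Filter.Eventually.of_forall fun u => by simp only [hf, Pi.zero_apply]; positivity),
    integral_comp_abs]
  congr 1
  rw [hfi, setIntegral_indicator measurableSet_Iio, Set.Ioi_inter_Iio,
    ← integral_Ioc_eq_integral_Ioo, ← intervalIntegral.integral_of_le hr2.le,
    integral_rpow (Or.inl (by norm_num))]
  have : (-(1 / 2) : ℝ) + 1 = 1 / 2 := by norm_num
  rw [this, ← Real.sqrt_eq_rpow, Real.sqrt_sq hr.le, Real.zero_rpow (by norm_num)]
  ring

theorem lintegral_compl_ball_abs_rpow_eq {r : ℝ} (hr : 0 < r) :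
    ∫⁻ u : ℝ, ENNReal.ofReal (if |u| < r ^ 2 then 0 else |u| ^ (-2 : ℝ)) =
      ENNReal.ofReal (2 / r ^ 2) := by
  set f : ℝ → ℝ := fun u => if u < r ^ 2 then 0 else u ^ (-2 : ℝ) with hf
  have hfi : f = (Set.Ici (r ^ 2)).indicator (fun u => u ^ (-2 : ℝ)) := by
    ext u; simp only [hf, Set.indicator_apply, Set.mem_Ici, ← not_lt, ite_not]
  have hr2 : 0 < r ^ 2 := by positivity
  have hsub : Set.Ici (r ^ 2) ∩ Set.Ioi 0 = Set.Ici (r ^ 2) :=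
    Set.inter_eq_left.2 fun u hu => hr2.trans_le hu
  have hInt : IntegrableOn f (Set.Ioi 0) := by
    rw [hfi, integrableOn_indicator_iff measurableSet_Ici, hsub, integrableOn_Ici_iff_integrableOn_Ioi]
    exact integrableOn_Ioi_rpow_of_lt (by norm_num) hr2
  have hInt' : Integrable fun u : ℝ => f |u| := integrable_comp_abs hInt
  rw [← ofReal_integral_eq_lintegral_ofReal hInt'
    (Filter.Eventually.of_forall fun u => by simp only [hf, Pi.zero_apply]; positivity),
    integral_comp_abs]
  congr 1
  rw [hfi, setIntegral_indicator measurableSet_Ici, Set.inter_comm, hsub,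
    integral_Ici_eq_integral_Ioi, integral_Ioi_rpow_of_lt (by norm_num) hr2]
  have : (-2 : ℝ) + 1 = -1 := by norm_num
  rw [this, Real.rpow_neg_one]
  field_simp

theorem cube_mul_le_add {a c : ℝ} (ha : 0 ≤ a) (hc : 0 ≤ c) : a ^ 3 * c ≤ a ^ 4 + c ^ 4 := by
  rcases le_total a c with h | h
  · have : a ^ 3 * c ≤ c ^ 3 * c := by gcongr
    nlinarith [pow_nonneg ha 4]
  · have : a ^ 3 * c ≤ a ^ 3 * a := by gcongr
    nlinarith [pow_nonneg hc 4]

theorem lintegral_truncated_mul_kernel_le {a : ℝ → ℝ} (ha : Measurable a) (ha0 : ∀ x, 0 ≤ a x)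
    {n b : ℝ} (hn : 0 < n) (hb : 0 < b)
    (h : ∫⁻ x, ENNReal.ofReal (a x ^ 4) ≤ ENNReal.ofReal (n ^ 2)) (x : ℝ) :
    ∫⁻ y, ENNReal.ofReal ((if a y ≤ b then a y ^ 3 else 0) * |x - y| ^ (-(1 / 2) : ℝ)) ≤
      ENNReal.ofReal (7 * b * n) := by
  set r := n / b ^ 2 with hr
  have hr0 : 0 < r := by positivity
  have hn' : n = r * b ^ 2 := by rw [hr]; field_simp
  have hpt : ∀ y, ENNReal.ofReal ((if a y ≤ b then a y ^ 3 else 0) * |x - y| ^ (-(1 / 2) : ℝ)) ≤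
      ENNReal.ofReal (b ^ 3) *
        ENNReal.ofReal (if |x - y| < r ^ 2 then |x - y| ^ (-(1 / 2) : ℝ) else 0) +
      (ENNReal.ofReal (1 / (r * b)) * ENNReal.ofReal (a y ^ 4) + ENNReal.ofReal (r ^ 3 * b ^ 3) *
        ENNReal.ofReal (if |x - y| < r ^ 2 then 0 else |x - y| ^ (-2 : ℝ))) := by
    intro y
    have h4 : 0 ≤ a y ^ 4 := by positivity
    rw [← ENNReal.ofReal_mul (by positivity), ← ENNReal.ofReal_mul (by positivity),
      ← ENNReal.ofReal_mul (by positivity), ← ENNReal.ofReal_add (by positivity) (by positivity),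
      ← ENNReal.ofReal_add (by positivity) (by positivity)]
    apply ENNReal.ofReal_le_ofReal
    have h0 := ha0 y
    have hra : 0 ≤ 1 / (r * b) * a y ^ 4 := by positivity
    set u := |x - y| with hu
    have hu0 : 0 ≤ u := abs_nonneg _
    by_cases hur : u < r ^ 2
    · have hle : (if a y ≤ b then a y ^ 3 else 0) ≤ b ^ 3 := by
        split_ifs with hab
        · gcongr
        · positivity
      simp only [hur, if_true, mul_zero, add_zero]
      have := mul_le_mul_of_nonneg_right hle (Real.rpow_nonneg hu0 (-(1 / 2)))
      linarith
    · have hle : (if a y ≤ b then a y ^ 3 else 0) ≤ a y ^ 3 := by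
        split_ifs with hab
        · exact le_rfl
        · positivity
      simp only [hur, if_false, mul_zero, zero_add]
      have hk := Real.rpow_nonneg hu0 (-(1 / 2))
      refine (mul_le_mul_of_nonneg_right hle hk).trans ?_
      have hk4 : (u ^ (-(1 / 2) : ℝ)) ^ 4 = u ^ (-2 : ℝ) := by
        rw [← Real.rpow_natCast, ← Real.rpow_mul hu0]
        norm_num
      have := cube_mul_le_add h0 (c := u ^ (-(1 / 2) : ℝ) * (r * b)) (by positivity)
      rw [mul_pow, hk4, ← mul_assoc, ← le_div_iff₀ (by positivity)] at this
      refine this.trans (le_of_eq ?_)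
      field_simp
  refine (lintegral_mono hpt).trans ?_
  have m1 : Measurable fun y : ℝ => ENNReal.ofReal (if |x - y| < r ^ 2 then |x - y| ^ (-(1 / 2) : ℝ) else 0) :=
    (Measurable.ite (measurableSet_lt (by fun_prop) (by fun_prop)) (by fun_prop) (by fun_prop)).ennreal_ofReal
  rw [lintegral_add_left (m1.const_mul _), lintegral_const_mul _ m1,
    lintegral_add_left (by fun_prop), lintegral_const_mul _ (by fun_prop),
    lintegral_const_mul' _ _ (by simp),
    lintegral_sub_left_eq_self (fun u : ℝ => ENNReal.ofReal (if |u| < r ^ 2 then |u| ^ (-(1 / 2) : ℝ) else 0)) x,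
    lintegral_sub_left_eq_self (fun u : ℝ => ENNReal.ofReal (if |u| < r ^ 2 then 0 else |u| ^ (-2 : ℝ))) x,
    lintegral_ball_abs_rpow_eq hr0, lintegral_compl_ball_abs_rpow_eq hr0]
  refine (add_le_add_right (add_le_add_left (mul_le_mul_right h _) _) _).trans ?_
  rw [← ENNReal.ofReal_mul (by positivity), ← ENNReal.ofReal_mul (by positivity),
      ← ENNReal.ofReal_mul (by positivity), ← ENNReal.ofReal_add (by positivity) (by positivity),
      ← ENNReal.ofReal_add (by positivity) (by positivity)]
  apply ENNReal.ofReal_le_ofReal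
  rw [hn']
  apply le_of_eq
  field_simp
  ring

theorem lintegral_lintegral_mul_kernel_le {a : ℝ → ℝ} (ha : Measurable a) (ha0 : ∀ x, 0 ≤ a x)
    {n : ℝ} (hn : 0 < n) (h : ∫⁻ x, ENNReal.ofReal (a x ^ 4) ≤ ENNReal.ofReal (n ^ 2)) :
    ∫⁻ x, ∫⁻ y, ENNReal.ofReal (a x ^ 3 * a y ^ 3 * |x - y| ^ (-(1 / 2) : ℝ)) ≤
      ENNReal.ofReal (14 * n ^ 3) := by
  set k : ℝ → ℝ → ENNReal := fun x y =>
    ENNReal.ofReal (a x ^ 3) *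
      ENNReal.ofReal ((if a y ≤ a x then a y ^ 3 else 0) * |x - y| ^ (-(1 / 2) : ℝ)) with hk
  have hkm : Measurable (Function.uncurry k) := by
    refine Measurable.mul (by fun_prop) (Measurable.ennreal_ofReal (Measurable.mul ?_ (by fun_prop)))
    exact Measurable.ite (measurableSet_le (by fun_prop) (by fun_prop)) (by fun_prop) (by fun_prop)
  have hhalf : ∫⁻ x, ∫⁻ y, k x y ≤ ENNReal.ofReal (7 * n ^ 3) := by
    have hx : ∀ x, ∫⁻ y, k x y ≤ ENNReal.ofReal (7 * n) * ENNReal.ofReal (a x ^ 4) := by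
      intro x
      rw [hk, lintegral_const_mul' _ _ (by simp)]
      rcases (ha0 x).eq_or_lt with h0 | h0
      · simp [← h0]
      · refine (mul_le_mul_right (lintegral_truncated_mul_kernel_le ha ha0 hn h0 h x) _).trans ?_
        rw [← ENNReal.ofReal_mul (by positivity), ← ENNReal.ofReal_mul (by positivity)]
        apply le_of_eq
        congr 1
        ring
    refine (lintegral_mono hx).trans ?_
    rw [lintegral_const_mul' _ _ ENNReal.ofReal_ne_top]
    refine (mul_le_mul_right h _).trans ?_
    rw [← ENNReal.ofReal_mul (by positivity)]
    apply le_of_eq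
    congr 1
    ring
  have hpt : ∀ x y, ENNReal.ofReal (a x ^ 3 * a y ^ 3 * |x - y| ^ (-(1 / 2) : ℝ)) ≤
      k x y + k y x := by
    intro x y
    have hx := ha0 x
    have hy := ha0 y
    rcases le_total (a y) (a x) with hxy | hxy
    · refine le_add_right (le_of_eq ?_)
      simp only [hk, hxy, if_true]
      rw [← ENNReal.ofReal_mul (by positivity), mul_assoc]
    · refine le_add_left (le_of_eq ?_)
      simp only [hk, hxy, if_true]
      rw [← ENNReal.ofReal_mul (by positivity), abs_sub_comm y x]
      congr 1
      ring
  clear_value k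
  calc ∫⁻ x, ∫⁻ y, ENNReal.ofReal (a x ^ 3 * a y ^ 3 * |x - y| ^ (-(1 / 2) : ℝ))
      ≤ ∫⁻ x, ∫⁻ y, (k x y + k y x) := lintegral_mono fun x => lintegral_mono fun y => hpt x y
    _ = ∫⁻ x, ((∫⁻ y, k x y) + ∫⁻ y, k y x) := by
        refine lintegral_congr fun x => lintegral_add_left ?_ _
        exact hkm.comp (measurable_const.prodMk measurable_id)
    _ = (∫⁻ x, ∫⁻ y, k x y) + ∫⁻ x, ∫⁻ y, k y x := lintegral_add_left hkm.lintegral_prod_right' _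
    _ = (∫⁻ x, ∫⁻ y, k x y) + ∫⁻ y, ∫⁻ x, k y x := by
        congr 1
        exact lintegral_lintegral_swap (f := fun x y => k y x) (hkm.comp measurable_swap).aemeasurable
    _ ≤ ENNReal.ofReal (7 * n ^ 3) + ENNReal.ofReal (7 * n ^ 3) := add_le_add hhalf hhalf
    _ = ENNReal.ofReal (14 * n ^ 3) := by
        rw [← ENNReal.ofReal_add (by positivity) (by positivity)]
        congr 1
        ring

open ComplexConjugate in
theorem integral_norm_sq_dual_le {Z : Type*} [MeasurableSpace Z] (μ : Measure Z)
    [IsFiniteMeasure μ] {E : ℝ → Z → ℂ} (hE : Measurable (Function.uncurry E))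
    (hE1 : ∀ x z, ‖E x z‖ ≤ 1) {K : ℝ} (hK : 0 ≤ K)
    (hEK : ∀ x x', x ≠ x' →
      ‖∫ z, E x z * conj (E x' z) ∂μ‖ ≤ K * |x - x'| ^ (-(1 / 2) : ℝ))
    {h : ℝ → ℂ} (hm : Measurable h) (hi : Integrable h) {a : ℝ → ℝ} (ha : Measurable a)
    (ha0 : ∀ x, 0 ≤ a x) (hha : ∀ x, ‖h x‖ = a x ^ 3) {n : ℝ} (hn : 0 < n)
    (han : ∫⁻ x, ENNReal.ofReal (a x ^ 4) ≤ ENNReal.ofReal (n ^ 2)) :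
    ∫ z, ‖∫ x, E x z * h x‖ ^ 2 ∂μ ≤ K * (14 * n ^ 3) := by
  set Φ : Z → ℝ × ℝ → ℂ := fun z p => E p.1 z * h p.1 * conj (E p.2 z * h p.2) with hΦ
  have hΦm : Measurable (Function.uncurry Φ) := by
    have h1 : Measurable fun q : Z × (ℝ × ℝ) => E q.2.1 q.1 :=
      hE.comp (f := fun q : Z × (ℝ × ℝ) => (q.2.1, q.1)) (by fun_prop)
    have h2 : Measurable fun q : Z × (ℝ × ℝ) => E q.2.2 q.1 :=
      hE.comp (f := fun q : Z × (ℝ × ℝ) => (q.2.2, q.1)) (by fun_prop)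
    exact (h1.mul (by fun_prop)).mul
      (Complex.continuous_conj.measurable.comp (h2.mul (by fun_prop)))
  have hΦi : Integrable (Function.uncurry Φ) (μ.prod (volume.prod volume)) := by
    have hb : Integrable (fun q : Z × (ℝ × ℝ) => ‖h q.2.1‖ * ‖h q.2.2‖)
        (μ.prod (volume.prod volume)) :=
      (hi.norm.mul_prod hi.norm).comp_snd μ
    refine hb.mono' hΦm.aestronglyMeasurable (Filter.Eventually.of_forall fun q => ?_)
    simp only [Function.uncurry, hΦ, norm_mul, RCLike.norm_conj]
    have e1 := hE1 q.2.1 q.1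
    have e2 := hE1 q.2.2 q.1
    have : ‖E q.2.1 q.1‖ * ‖E q.2.2 q.1‖ ≤ 1 := mul_le_one₀ e1 (norm_nonneg _) e2
    calc ‖E q.2.1 q.1‖ * ‖h q.2.1‖ * (‖E q.2.2 q.1‖ * ‖h q.2.2‖)
        = (‖E q.2.1 q.1‖ * ‖E q.2.2 q.1‖) * (‖h q.2.1‖ * ‖h q.2.2‖) := by ring
      _ ≤ 1 * (‖h q.2.1‖ * ‖h q.2.2‖) := by gcongr
      _ = _ := one_mul _
  have hsq : ∀ z, ((‖∫ x, E x z * h x‖ ^ 2 : ℝ) : ℂ) = ∫ p, Φ z p ∂(volume.prod volume) := by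
    intro z
    rw [hΦ, integral_prod_mul (fun x => E x z * h x) (fun x => conj (E x z * h x)), integral_conj,
      Complex.mul_conj, Complex.normSq_eq_norm_sq]
  have hswap : ((∫ z, ‖∫ x, E x z * h x‖ ^ 2 ∂μ : ℝ) : ℂ) =
      ∫ p, (h p.1 * conj (h p.2)) * ∫ z, E p.1 z * conj (E p.2 z) ∂μ ∂(volume.prod volume) := by
    rw [← integral_complex_ofReal]
    simp_rw [hsq]
    rw [integral_integral_swap hΦi]
    refine integral_congr_ae (Filter.Eventually.of_forall fun p => ?_)
    simp only
    rw [← integral_const_mul]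
    refine integral_congr_ae (Filter.Eventually.of_forall fun z => ?_)
    simp only [hΦ, map_mul]
    ring
  have hpos : 0 ≤ ∫ z, ‖∫ x, E x z * h x‖ ^ 2 ∂μ := integral_nonneg fun z => by positivity
  have hJm : Measurable fun p : ℝ × ℝ =>
      (h p.1 * conj (h p.2)) * ∫ z, E p.1 z * conj (E p.2 z) ∂μ := by
    refine Measurable.mul ((hm.comp measurable_fst).mul
      (Complex.continuous_conj.measurable.comp (hm.comp measurable_snd))) ?_
    have h1 : Measurable fun q : (ℝ × ℝ) × Z => E q.1.1 q.2 :=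
      hE.comp (f := fun q : (ℝ × ℝ) × Z => (q.1.1, q.2)) (by fun_prop)
    have h2 : Measurable fun q : (ℝ × ℝ) × Z => E q.1.2 q.2 :=
      hE.comp (f := fun q : (ℝ × ℝ) × Z => (q.1.2, q.2)) (by fun_prop)
    exact ((h1.mul (Complex.continuous_conj.measurable.comp
      h2)).stronglyMeasurable.integral_prod_right' (ν := μ)).measurable
  have hpt : ∀ x, ∀ᵐ y, ‖(h x * conj (h y)) * ∫ z, E x z * conj (E y z) ∂μ‖ₑ ≤
      ENNReal.ofReal K * ENNReal.ofReal (a x ^ 3 * a y ^ 3 * |x - y| ^ (-(1 / 2) : ℝ)) := by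
    intro x
    filter_upwards [Measure.ae_ne volume x] with y hy
    rw [← ENNReal.ofReal_mul hK, ← ofReal_norm]
    apply ENNReal.ofReal_le_ofReal
    rw [norm_mul, norm_mul, RCLike.norm_conj, hha, hha]
    have := hEK x y (Ne.symm hy)
    have := ha0 x
    have := ha0 y
    calc a x ^ 3 * a y ^ 3 * ‖∫ z, E x z * conj (E y z) ∂μ‖
        ≤ a x ^ 3 * a y ^ 3 * (K * |x - y| ^ (-(1 / 2) : ℝ)) := by gcongr
      _ = _ := by ring
  have key : ENNReal.ofReal (∫ z, ‖∫ x, E x z * h x‖ ^ 2 ∂μ) ≤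
      ENNReal.ofReal (K * (14 * n ^ 3)) := by
    calc ENNReal.ofReal (∫ z, ‖∫ x, E x z * h x‖ ^ 2 ∂μ)
        = ‖((∫ z, ‖∫ x, E x z * h x‖ ^ 2 ∂μ : ℝ) : ℂ)‖ₑ := by
          rw [← ofReal_norm, Complex.norm_real, Real.norm_of_nonneg hpos]
      _ ≤ ∫⁻ p : ℝ × ℝ, ‖(h p.1 * conj (h p.2)) * ∫ z, E p.1 z * conj (E p.2 z) ∂μ‖ₑ
            ∂(volume.prod volume) := by
          rw [hswap]
          exact enorm_integral_le_lintegral_enorm _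
      _ = ∫⁻ x, ∫⁻ y, ‖(h x * conj (h y)) * ∫ z, E x z * conj (E y z) ∂μ‖ₑ :=
          lintegral_prod _ hJm.enorm.aemeasurable
      _ ≤ ∫⁻ x, ∫⁻ y, ENNReal.ofReal K *
            ENNReal.ofReal (a x ^ 3 * a y ^ 3 * |x - y| ^ (-(1 / 2) : ℝ)) :=
          lintegral_mono fun x => lintegral_mono_ae (hpt x)
      _ = ENNReal.ofReal K * ∫⁻ x, ∫⁻ y,
            ENNReal.ofReal (a x ^ 3 * a y ^ 3 * |x - y| ^ (-(1 / 2) : ℝ)) := by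
          simp_rw [lintegral_const_mul' _ _ ENNReal.ofReal_ne_top]
      _ ≤ ENNReal.ofReal K * ENNReal.ofReal (14 * n ^ 3) := by
          gcongr
          exact lintegral_lintegral_mul_kernel_le ha ha0 hn han
      _ = _ := by rw [← ENNReal.ofReal_mul hK]
  exact (ENNReal.ofReal_le_ofReal_iff (by positivity)).1 key

theorem integral_norm_mul_le_sqrt_mul_sqrt {Z : Type*} [MeasurableSpace Z] {μ : Measure Z}
    {G H : Z → ℂ} (hG : MemLp G 2 μ) (hH : MemLp H 2 μ) :
    ∫ z, ‖G z‖ * ‖H z‖ ∂μ ≤ √(∫ z, ‖G z‖ ^ 2 ∂μ) * √(∫ z, ‖H z‖ ^ 2 ∂μ) := by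
  have := integral_mul_le_Lp_mul_Lq_of_nonneg (μ := μ) Real.HolderConjugate.two_two
    (f := fun z => ‖G z‖) (g := fun z => ‖H z‖)
    (Filter.Eventually.of_forall fun z => norm_nonneg _)
    (Filter.Eventually.of_forall fun z => norm_nonneg _)
    (by simpa using hG.norm) (by simpa using hH.norm)
  simpa [Real.sqrt_eq_rpow] using this

open ComplexConjugate in
theorem lintegral_indicator_extension_pow_four_le {Z : Type*} [MeasurableSpace Z] (μ : Measure Z)
    [IsFiniteMeasure μ] {E : ℝ → Z → ℂ} (hE : Measurable (Function.uncurry E))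
    (hE1 : ∀ x z, ‖E x z‖ ≤ 1) {K : ℝ} (hK : 0 ≤ K)
    (hEK : ∀ x x', x ≠ x' →
      ‖∫ z, E x z * conj (E x' z) ∂μ‖ ≤ K * |x - x'| ^ (-(1 / 2) : ℝ))
    {G : Z → ℂ} (hG : Measurable G) (hG2 : MemLp G 2 μ) (R : ℝ) :
    ∫⁻ x in Set.Icc (-R) R, ENNReal.ofReal (‖∫ z, E x z * G z ∂μ‖ ^ 4) ≤
      ENNReal.ofReal ((14 * K * ∫ z, ‖G z‖ ^ 2 ∂μ) ^ 2) := by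
  set F : ℝ → ℂ := fun x => ∫ z, E x z * G z ∂μ with hF
  have hGi : Integrable G μ := hG2.integrable (by norm_num)
  have hFm : Measurable F :=
    ((hE.mul (hG.comp measurable_snd)).stronglyMeasurable.integral_prod_right' (ν := μ)).measurable
  set B := ∫ z, ‖G z‖ ∂μ with hB
  have hFB : ∀ x, ‖F x‖ ≤ B := fun x =>
    norm_integral_le_of_norm_le hGi.norm (Filter.Eventually.of_forall fun z => by
      rw [norm_mul]
      exact mul_le_of_le_one_left (norm_nonneg _) (hE1 x z))
  set S := Set.Icc (-R) R with hS
  have hSm : MeasurableSet S := measurableSet_Icc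
  have hSf : volume S ≠ ⊤ := by simp [hS]
  set a : ℝ → ℝ := S.indicator fun x => ‖F x‖ with ha
  have ham : Measurable a := hFm.norm.indicator hSm
  have ha0 : ∀ x, 0 ≤ a x := Set.indicator_nonneg fun x _ => norm_nonneg _
  set h : ℝ → ℂ := S.indicator fun x => conj (F x) * (‖F x‖ ^ 2 : ℝ) with hh
  have hcm : Measurable fun x => conj (F x) * ((‖F x‖ ^ 2 : ℝ) : ℂ) :=
    (Complex.continuous_conj.measurable.comp hFm).mul
      (Complex.measurable_ofReal.comp (hFm.norm.pow_const 2))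
  have hhm : Measurable h := hcm.indicator hSm
  have hha : ∀ x, ‖h x‖ = a x ^ 3 := by
    intro x
    by_cases hx : x ∈ S
    · simp only [hh, ha, Set.indicator_of_mem hx, norm_mul, RCLike.norm_conj, Complex.norm_real,
        norm_pow, norm_norm]
      ring
    · simp [hh, ha, Set.indicator_of_notMem hx]
  have hhi : Integrable h := by
    rw [hh, integrable_indicator_iff hSm]
    refine Measure.integrableOn_of_bounded (M := B * B ^ 2) hSf hcm.aestronglyMeasurable
      (Filter.Eventually.of_forall fun x => ?_)
    rw [norm_mul, RCLike.norm_conj, Complex.norm_real, norm_pow, norm_norm]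
    have := hFB x
    gcongr
  have h4i : IntegrableOn (fun x => ‖F x‖ ^ 4) S := by
    refine Measure.integrableOn_of_bounded (M := B ^ 4) hSf
      (hFm.norm.pow_const 4).aestronglyMeasurable (Filter.Eventually.of_forall fun x => ?_)
    rw [norm_pow, norm_norm]
    have := hFB x
    gcongr
  set n := √(∫ x in S, ‖F x‖ ^ 4) with hn
  have hI0 : 0 ≤ ∫ x in S, ‖F x‖ ^ 4 := integral_nonneg fun x => by positivity
  have hn2 : n ^ 2 = ∫ x in S, ‖F x‖ ^ 4 := Real.sq_sqrt hI0
  have hleq : ∫⁻ x in S, ENNReal.ofReal (‖F x‖ ^ 4) = ENNReal.ofReal (n ^ 2) := by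
    rw [hn2, ofReal_integral_eq_lintegral_ofReal h4i
      (Filter.Eventually.of_forall fun x => by simp only [Pi.zero_apply]; positivity)]
  rw [hleq]
  apply ENNReal.ofReal_le_ofReal
  set g := ∫ z, ‖G z‖ ^ 2 ∂μ with hg
  have hg0 : 0 ≤ g := integral_nonneg fun z => by positivity
  have hn0 : 0 ≤ n := Real.sqrt_nonneg _
  refine pow_le_pow_left₀ hn0 ?_ 2
  rcases hn0.eq_or_lt with hz | hnpos
  · rw [← hz]; positivity
  have han : ∫⁻ x, ENNReal.ofReal (a x ^ 4) ≤ ENNReal.ofReal (n ^ 2) := by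
    rw [← hleq, ← lintegral_indicator hSm]
    refine lintegral_mono fun x => ?_
    by_cases hx : x ∈ S <;> simp [ha, hx]
  have hdual := integral_norm_sq_dual_le μ hE hE1 hK hEK hhm hhi ham ha0 hha hnpos han
  set H : Z → ℂ := fun z => ∫ x, E x z * h x with hH
  have hHm : Measurable H :=
    ((hE.mul (hhm.comp measurable_fst)).stronglyMeasurable.integral_prod_left' (μ := volume)).measurable
  have hH2 : MemLp H 2 μ := MemLp.of_bound hHm.aestronglyMeasurable (∫ x, ‖h x‖)
    (Filter.Eventually.of_forall fun z =>
      norm_integral_le_of_norm_le hhi.norm (Filter.Eventually.of_forall fun x => by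
        rw [norm_mul]
        exact mul_le_of_le_one_left (norm_nonneg _) (hE1 x z)))
  have hprod : Integrable (Function.uncurry fun x z => E x z * G z * h x) (volume.prod μ) := by
    refine (hhi.norm.mul_prod hGi.norm).mono'
      ((hE.mul (hG.comp measurable_snd)).mul (hhm.comp measurable_fst)).aestronglyMeasurable
      (Filter.Eventually.of_forall fun q => ?_)
    simp only [Function.uncurry, norm_mul]
    calc ‖E q.1 q.2‖ * ‖G q.2‖ * ‖h q.1‖ ≤ 1 * ‖G q.2‖ * ‖h q.1‖ := by gcongr; exact hE1 _ _
      _ = _ := by ring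
  have hpair : ((n ^ 2 : ℝ) : ℂ) = ∫ z, G z * H z ∂μ := by
    rw [hn2, ← integral_complex_ofReal, ← integral_indicator hSm]
    calc ∫ x, S.indicator (fun x => ((‖F x‖ ^ 4 : ℝ) : ℂ)) x
        = ∫ x, ∫ z, E x z * G z * h x ∂μ := by
          refine integral_congr_ae (Filter.Eventually.of_forall fun x => ?_)
          simp only [integral_mul_const]
          by_cases hx : x ∈ S
          · simp only [hh, Set.indicator_of_mem hx]
            rw [← mul_assoc, Complex.mul_conj, Complex.normSq_eq_norm_sq]
            push_cast
            ring
          · simp [hh, Set.indicator_of_notMem hx]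
      _ = ∫ z, (∫ x, E x z * G z * h x) ∂μ := integral_integral_swap hprod
      _ = ∫ z, G z * H z ∂μ := by
          refine integral_congr_ae (Filter.Eventually.of_forall fun z => ?_)
          simp only [hH]
          rw [← integral_const_mul]
          refine integral_congr_ae (Filter.Eventually.of_forall fun x => ?_)
          simp only
          ring
  have hle : n ^ 2 ≤ √g * √(K * (14 * n ^ 3)) := by
    calc n ^ 2 = ‖((n ^ 2 : ℝ) : ℂ)‖ := by
          rw [Complex.norm_real, Real.norm_of_nonneg (by positivity)]
      _ ≤ ∫ z, ‖G z * H z‖ ∂μ := by rw [hpair]; exact norm_integral_le_integral_norm _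
      _ = ∫ z, ‖G z‖ * ‖H z‖ ∂μ := by simp_rw [norm_mul]
      _ ≤ √g * √(∫ z, ‖H z‖ ^ 2 ∂μ) := integral_norm_mul_le_sqrt_mul_sqrt hG2 hH2
      _ ≤ _ := by gcongr
  have hsq : (n ^ 2) ^ 2 ≤ g * (K * (14 * n ^ 3)) := by
    calc (n ^ 2) ^ 2 ≤ (√g * √(K * (14 * n ^ 3))) ^ 2 := by gcongr
      _ = _ := by rw [mul_pow, Real.sq_sqrt hg0, Real.sq_sqrt (by positivity)]
  have hn3 : 0 < n ^ 3 := by positivity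
  refine le_of_mul_le_mul_right ?_ hn3
  calc n * n ^ 3 = (n ^ 2) ^ 2 := by ring
    _ ≤ g * (K * (14 * n ^ 3)) := hsq
    _ = _ := by ring

open ComplexConjugate in
theorem lintegral_extension_pow_four_le {Z : Type*} [MeasurableSpace Z] (μ : Measure Z)
    [IsFiniteMeasure μ] {E : ℝ → Z → ℂ} (hE : Measurable (Function.uncurry E))
    (hE1 : ∀ x z, ‖E x z‖ ≤ 1) {K : ℝ} (hK : 0 ≤ K)
    (hEK : ∀ x x', x ≠ x' →
      ‖∫ z, E x z * conj (E x' z) ∂μ‖ ≤ K * |x - x'| ^ (-(1 / 2) : ℝ))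
    {G : Z → ℂ} (hG : Measurable G) (hG2 : MemLp G 2 μ) :
    ∫⁻ x, ENNReal.ofReal (‖∫ z, E x z * G z ∂μ‖ ^ 4) ≤
      ENNReal.ofReal ((14 * K * ∫ z, ‖G z‖ ^ 2 ∂μ) ^ 2) := by
  have hU : ⋃ N : ℕ, Set.Icc (-(N : ℝ)) N = Set.univ := by
    refine Set.eq_univ_of_forall fun x => Set.mem_iUnion.2 ?_
    obtain ⟨N, hN⟩ := exists_nat_ge |x|
    exact ⟨N, abs_le.1 hN⟩
  rw [← setLIntegral_univ, ← hU, setLIntegral_iUnion_of_directed]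
  · exact iSup_le fun N => lintegral_indicator_extension_pow_four_le μ hE hE1 hK hEK hG hG2 N
  · refine Monotone.directed_le fun m N hmN => Set.Icc_subset_Icc ?_ ?_ <;> simpa using hmN

theorem integrable_one_add_sq_rpow_neg {s : ℝ} (hs : 1 / 2 < s) :
    Integrable fun η : ℝ => (1 + η ^ 2) ^ (-s) := by
  have := integrable_rpow_neg_one_add_norm_sq (μ := (volume : Measure ℝ)) (r := 2 * s)
    (by simp; linarith)
  simpa [neg_div] using this

/-- The frequency weight used to factor the maximal operator through `L²`. -/
noncomputable def freqWeight (s M : ℝ) (ζ : ℝ × ℝ) : ℝ :=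
  (if |ζ.1| ≤ M then |ζ.1| ^ (-(1 / 2) : ℝ) else 0) * (1 + ζ.2 ^ 2) ^ (-s)

theorem freqWeight_nonneg (s M : ℝ) (ζ : ℝ × ℝ) : 0 ≤ freqWeight s M ζ := by
  unfold freqWeight
  positivity

theorem measurable_freqWeight (s M : ℝ) : Measurable (freqWeight s M) := by
  unfold freqWeight
  exact (Measurable.ite (measurableSet_le (by fun_prop) (by fun_prop)) (by fun_prop)
    (by fun_prop)).mul (by fun_prop)

theorem integrable_freqWeight {s : ℝ} (hs : 1 / 2 < s) (M : ℝ) : Integrable (freqWeight s M) :=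
  (integrable_indicator_abs_rpow M).mul_prod (integrable_one_add_sq_rpow_neg hs)

/-- The space-time oscillation `e^{i(xξ+yη+t(ξ³+η³))}` with `(y,t) = q`. -/
noncomputable def osc (x : ℝ) (q ζ : ℝ × ℝ) : ℂ :=
  Complex.exp (Complex.I * ((x * ζ.1 + q.1 * ζ.2 + q.2 * (ζ.1 ^ 3 + ζ.2 ^ 3) : ℝ) : ℂ))

theorem norm_osc (x : ℝ) (q ζ : ℝ × ℝ) : ‖osc x q ζ‖ = 1 := by
  unfold osc
  rw [mul_comm, Complex.norm_exp_ofReal_mul_I]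

theorem continuous_osc : Continuous fun p : ℝ × (ℝ × ℝ) × (ℝ × ℝ) => osc p.1 p.2.1 p.2.2 := by
  unfold osc
  fun_prop

/-- The measure with density `freqWeight s M`. -/
noncomputable def freqMeasure (s M : ℝ) : Measure (ℝ × ℝ) :=
  volume.withDensity fun ζ => ENNReal.ofReal (freqWeight s M ζ)

theorem isFiniteMeasure_freqMeasure {s : ℝ} (hs : 1 / 2 < s) (M : ℝ) :
    IsFiniteMeasure (freqMeasure s M) :=
  isFiniteMeasure_withDensity_ofReal (integrable_freqWeight hs M).hasFiniteIntegral

theorem integral_freqMeasure {V : Type*} [NormedAddCommGroup V] [NormedSpace ℝ V] (s M : ℝ)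
    (g : ℝ × ℝ → V) :
    ∫ ζ, g ζ ∂freqMeasure s M = ∫ ζ, freqWeight s M ζ • g ζ := by
  rw [freqMeasure, integral_withDensity_eq_integral_toReal_smul
    (measurable_freqWeight s M).ennreal_ofReal (Filter.Eventually.of_forall fun _ => by simp)]
  simp_rw [ENNReal.toReal_ofReal (freqWeight_nonneg s M _)]

open ComplexConjugate in
theorem norm_integral_osc_mul_conj_osc_le (s M : ℝ) {x x' : ℝ} (hx : x ≠ x') (q q' : ℝ × ℝ) :
    ‖∫ ζ, osc x q ζ * conj (osc x' q' ζ) ∂freqMeasure s M‖ ≤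
      4 * (1 + 11 * Real.pi) * (∫ η : ℝ, (1 + η ^ 2) ^ (-s)) * |x - x'| ^ (-(1 / 2) : ℝ) := by
  set f₁ : ℝ → ℂ := fun ξ => ((if |ξ| ≤ M then |ξ| ^ (-(1 / 2) : ℝ) else 0 : ℝ) : ℂ) *
    Complex.exp (Complex.I * (((x - x') * ξ + (q.2 - q'.2) * ξ ^ 3 : ℝ) : ℂ)) with hf₁
  set f₂ : ℝ → ℂ := fun η => (((1 + η ^ 2) ^ (-s) : ℝ) : ℂ) *
    Complex.exp ((((q.1 - q'.1) * η + (q.2 - q'.2) * η ^ 3 : ℝ) : ℂ) * Complex.I) with hf₂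
  have hfac : ∀ ζ : ℝ × ℝ, freqWeight s M ζ • (osc x q ζ * conj (osc x' q' ζ)) =
      f₁ ζ.1 * f₂ ζ.2 := by
    intro ζ
    have hexp : osc x q ζ * conj (osc x' q' ζ) =
        Complex.exp (Complex.I * (((x - x') * ζ.1 + (q.2 - q'.2) * ζ.1 ^ 3 : ℝ) : ℂ)) *
        Complex.exp ((((q.1 - q'.1) * ζ.2 + (q.2 - q'.2) * ζ.2 ^ 3 : ℝ) : ℂ) * Complex.I) := by
      unfold osc
      rw [← Complex.exp_conj, map_mul, Complex.conj_I, Complex.conj_ofReal, ← Complex.exp_add,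
        ← Complex.exp_add]
      congr 1
      push_cast
      ring
    rw [hexp, Complex.real_smul, freqWeight, Complex.ofReal_mul]
    simp only [hf₁, hf₂]
    ring
  rw [integral_freqMeasure]
  simp_rw [hfac]
  rw [Measure.volume_eq_prod, integral_prod_mul f₁ f₂, norm_mul]
  have h₁ : ‖∫ ξ, f₁ ξ‖ ≤ 4 * (1 + 11 * Real.pi) * |x - x'| ^ (-(1 / 2) : ℝ) :=
    norm_integral_indicator_abs_rpow_mul_exp_le (sub_ne_zero.2 hx) _ M
  have h₂ : ‖∫ η, f₂ η‖ ≤ ∫ η : ℝ, (1 + η ^ 2) ^ (-s) := by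
    refine (norm_integral_le_integral_norm _).trans (le_of_eq ?_)
    refine integral_congr_ae (Filter.Eventually.of_forall fun η => ?_)
    simp only [hf₂]
    rw [norm_mul, Complex.norm_exp_ofReal_mul_I, mul_one, Complex.norm_real,
      Real.norm_of_nonneg (by positivity)]
  calc ‖∫ ξ, f₁ ξ‖ * ‖∫ η, f₂ η‖
      ≤ (4 * (1 + 11 * Real.pi) * |x - x'| ^ (-(1 / 2) : ℝ)) * ∫ η : ℝ, (1 + η ^ 2) ^ (-s) :=
        mul_le_mul h₁ h₂ (norm_nonneg _) (by positivity)
    _ = _ := by ring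

/-- The profile whose product with `freqWeight s M` is the frequency truncation of `g`. -/
noncomputable def reweight (s : ℝ) (g : ℝ × ℝ → ℂ) (ζ : ℝ × ℝ) : ℂ :=
  ((|ζ.1| ^ (1 / 2 : ℝ) * (1 + ζ.2 ^ 2) ^ s : ℝ) : ℂ) * g ζ

theorem freqWeight_mul_cancel (s M : ℝ) {ζ : ℝ × ℝ} (hζ : ζ.1 ≠ 0) :
    freqWeight s M ζ * (|ζ.1| ^ (1 / 2 : ℝ) * (1 + ζ.2 ^ 2) ^ s) = if |ζ.1| ≤ M then 1 else 0 := by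
  have h1 : 0 < |ζ.1| := abs_pos.2 hζ
  have h2 : 0 < 1 + ζ.2 ^ 2 := by positivity
  unfold freqWeight
  split_ifs
  · rw [mul_mul_mul_comm, ← Real.rpow_add h1, ← Real.rpow_add h2]
    norm_num
  · simp

theorem abs_rpow_mul_one_add_sq_rpow_le {s : ℝ} (hs : 0 ≤ s) (ζ : ℝ × ℝ) :
    |ζ.1| ^ (1 / 2 : ℝ) * (1 + ζ.2 ^ 2) ^ s ≤ (1 + ‖ζ‖ ^ 2) ^ (1 / 4 + s) := by
  have hpos : 0 < 1 + ‖ζ‖ ^ 2 := by positivity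
  have h1 : |ζ.1| ≤ ‖ζ‖ := norm_fst_le ζ
  have h2 : |ζ.2| ≤ ‖ζ‖ := norm_snd_le ζ
  rw [Real.rpow_add hpos]
  refine mul_le_mul ?_ ?_ (by positivity) (by positivity)
  · calc |ζ.1| ^ (1 / 2 : ℝ) = (|ζ.1| ^ 2) ^ (1 / 4 : ℝ) := by
          rw [← Real.rpow_natCast, ← Real.rpow_mul (abs_nonneg _)]
          norm_num
      _ ≤ (1 + ‖ζ‖ ^ 2) ^ (1 / 4 : ℝ) := by
          refine Real.rpow_le_rpow (by positivity) ?_ (by norm_num)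
          have : |ζ.1| ^ 2 ≤ ‖ζ‖ ^ 2 := by gcongr
          linarith
  · refine Real.rpow_le_rpow (by positivity) ?_ hs
    rw [← sq_abs ζ.2]
    gcongr

theorem freqWeight_mul_norm_reweight_sq_le {s : ℝ} (hs : 0 ≤ s) (M : ℝ) (g : ℝ × ℝ → ℂ)
    (ζ : ℝ × ℝ) :
    freqWeight s M ζ * ‖reweight s g ζ‖ ^ 2 ≤ (1 + ‖ζ‖ ^ 2) ^ (1 / 4 + s) * ‖g ζ‖ ^ 2 := by
  have hw := abs_rpow_mul_one_add_sq_rpow_le hs ζ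
  set v := |ζ.1| ^ (1 / 2 : ℝ) * (1 + ζ.2 ^ 2) ^ s with hv
  have hv0 : 0 ≤ v := by positivity
  have hcancel : freqWeight s M ζ * v ≤ 1 := by
    by_cases hζ : ζ.1 = 0
    · simp [hv, hζ]
    · rw [freqWeight_mul_cancel s M hζ]
      split_ifs <;> norm_num
  rw [reweight, ← hv, norm_mul, Complex.norm_real, Real.norm_of_nonneg hv0]
  calc freqWeight s M ζ * (v * ‖g ζ‖) ^ 2 = (freqWeight s M ζ * v) * (v * ‖g ζ‖ ^ 2) := by ring
    _ ≤ 1 * (v * ‖g ζ‖ ^ 2) := by gcongr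
    _ = v * ‖g ζ‖ ^ 2 := one_mul _
    _ ≤ _ := by gcongr

theorem measurable_reweight (s : ℝ) {g : ℝ × ℝ → ℂ} (hg : Measurable g) :
    Measurable (reweight s g) := by
  unfold reweight
  fun_prop

theorem memLp_two_reweight {s : ℝ} (hs : 0 ≤ s) (M : ℝ) {g : ℝ × ℝ → ℂ} (hg : Measurable g)
    (hg2 : Integrable fun ζ => (1 + ‖ζ‖ ^ 2) ^ (1 / 4 + s) * ‖g ζ‖ ^ 2) :
    MemLp (reweight s g) 2 (freqMeasure s M) ∧
      ∫ ζ, ‖reweight s g ζ‖ ^ 2 ∂freqMeasure s M ≤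
        ∫ ζ, (1 + ‖ζ‖ ^ 2) ^ (1 / 4 + s) * ‖g ζ‖ ^ 2 := by
  have hm := measurable_reweight s hg
  have hInt : Integrable fun ζ => freqWeight s M ζ * ‖reweight s g ζ‖ ^ 2 := by
    refine hg2.mono' ((measurable_freqWeight s M).mul
      (hm.norm.pow_const 2)).aestronglyMeasurable (Filter.Eventually.of_forall fun ζ => ?_)
    rw [Real.norm_of_nonneg (mul_nonneg (freqWeight_nonneg s M ζ) (by positivity))]
    exact freqWeight_mul_norm_reweight_sq_le hs M g ζ
  constructor
  · rw [memLp_two_iff_integrable_sq_norm hm.aestronglyMeasurable, freqMeasure,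
      integrable_withDensity_iff_integrable_smul' (measurable_freqWeight s M).ennreal_ofReal
        (Filter.Eventually.of_forall fun _ => by simp)]
    refine hInt.congr (Filter.Eventually.of_forall fun ζ => ?_)
    simp only [ENNReal.toReal_ofReal (freqWeight_nonneg s M _), smul_eq_mul]
  · rw [integral_freqMeasure]
    exact integral_mono hInt hg2 fun ζ => freqWeight_mul_norm_reweight_sq_le hs M g ζ

theorem integral_osc_mul_reweight (s M : ℝ) (x : ℝ) (q : ℝ × ℝ) (g : ℝ × ℝ → ℂ) :
    ∫ ζ, osc x q ζ * reweight s g ζ ∂freqMeasure s M =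
      ∫ ζ : ℝ × ℝ, if |ζ.1| ≤ M then osc x q ζ * g ζ else 0 := by
  rw [integral_freqMeasure]
  have hae : ∀ᵐ ζ : ℝ × ℝ, ζ.1 ≠ 0 :=
    Measure.quasiMeasurePreserving_fst.ae (Measure.ae_ne volume (0 : ℝ))
  refine integral_congr_ae ?_
  filter_upwards [hae] with ζ hζ
  have : freqWeight s M ζ • (osc x q ζ * reweight s g ζ) =
      ((freqWeight s M ζ * (|ζ.1| ^ (1 / 2 : ℝ) * (1 + ζ.2 ^ 2) ^ s) : ℝ) : ℂ) *
        (osc x q ζ * g ζ) := by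
    rw [Complex.real_smul, reweight, Complex.ofReal_mul (freqWeight s M ζ)]
    ring
  rw [this, freqWeight_mul_cancel s M hζ]
  split_ifs <;> simp

theorem lintegral_linearized_pow_four_le {s : ℝ} (hs : 1 / 2 < s) {g : ℝ × ℝ → ℂ}
    (hg : Measurable g) (hgi : Integrable g)
    (hg2 : Integrable fun ζ => (1 + ‖ζ‖ ^ 2) ^ (1 / 4 + s) * ‖g ζ‖ ^ 2)
    {σ : ℝ → ℝ × ℝ} (hσ : Measurable σ) :
    ∫⁻ x, ENNReal.ofReal (‖∫ ζ, osc x (σ x) ζ * g ζ‖ ^ 4) ≤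
      ENNReal.ofReal ((14 * (4 * (1 + 11 * Real.pi) * ∫ η : ℝ, (1 + η ^ 2) ^ (-s)) *
        ∫ ζ, (1 + ‖ζ‖ ^ 2) ^ (1 / 4 + s) * ‖g ζ‖ ^ 2) ^ 2) := by
  set K := 4 * (1 + 11 * Real.pi) * ∫ η : ℝ, (1 + η ^ 2) ^ (-s) with hK
  have hK0 : 0 ≤ K :=
    mul_nonneg (by positivity) (integral_nonneg fun η => by simp only [Pi.zero_apply]; positivity)
  have hE : Measurable (Function.uncurry fun x ζ => osc x (σ x) ζ) :=
    continuous_osc.measurable.comp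
      (measurable_fst.prodMk ((hσ.comp measurable_fst).prodMk measurable_snd))
  have htrunc : ∀ N : ℕ,
      ∫⁻ x, ENNReal.ofReal (‖∫ ζ, osc x (σ x) ζ * reweight s g ζ ∂freqMeasure s N‖ ^ 4) ≤
        ENNReal.ofReal ((14 * K * ∫ ζ, (1 + ‖ζ‖ ^ 2) ^ (1 / 4 + s) * ‖g ζ‖ ^ 2) ^ 2) := by
    intro N
    have := isFiniteMeasure_freqMeasure hs N
    obtain ⟨hL2, hle⟩ := memLp_two_reweight (by linarith) N hg hg2
    refine (lintegral_extension_pow_four_le (freqMeasure s N) hE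
      (fun x ζ => (norm_osc x (σ x) ζ).le) hK0
      (fun x x' hx => norm_integral_osc_mul_conj_osc_le s N hx _ _)
      (measurable_reweight s hg) hL2).trans ?_
    have h0 : 0 ≤ ∫ ζ, ‖reweight s g ζ‖ ^ 2 ∂freqMeasure s N :=
      integral_nonneg fun ζ => by positivity
    gcongr
  have hlim : ∀ x, Filter.Tendsto (fun N : ℕ =>
      ENNReal.ofReal (‖∫ ζ, osc x (σ x) ζ * reweight s g ζ ∂freqMeasure s N‖ ^ 4)) Filter.atTop
      (nhds (ENNReal.ofReal (‖∫ ζ, osc x (σ x) ζ * g ζ‖ ^ 4))) := by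
    intro x
    refine ENNReal.tendsto_ofReal (Filter.Tendsto.pow (Filter.Tendsto.norm ?_) 4)
    simp_rw [integral_osc_mul_reweight]
    have hom : Measurable fun ζ => osc x (σ x) ζ * g ζ := (hE.of_uncurry_left (x := x)).mul hg
    refine tendsto_integral_of_dominated_convergence (fun ζ => ‖g ζ‖) (fun N => ?_) hgi.norm
      (fun N => Filter.Eventually.of_forall fun ζ => ?_) (Filter.Eventually.of_forall fun ζ => ?_)
    · exact (Measurable.ite (measurableSet_le (by fun_prop) (by fun_prop)) hom
        measurable_const).aestronglyMeasurable
    · split_ifs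
      · rw [norm_mul, norm_osc, one_mul]
      · simp
    · refine tendsto_const_nhds.congr' ?_
      obtain ⟨N, hN⟩ := exists_nat_ge |ζ.1|
      filter_upwards [Filter.eventually_ge_atTop N] with m hm
      rw [if_pos (hN.trans (by exact_mod_cast hm))]
  have hmeas : ∀ N : ℕ, Measurable fun x =>
      ENNReal.ofReal (‖∫ ζ, osc x (σ x) ζ * reweight s g ζ ∂freqMeasure s N‖ ^ 4) := by
    intro N
    have := isFiniteMeasure_freqMeasure hs N
    have h : Measurable fun x => ∫ ζ, osc x (σ x) ζ * reweight s g ζ ∂freqMeasure s N :=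
      ((hE.mul ((measurable_reweight s hg).comp
        measurable_snd)).stronglyMeasurable.integral_prod_right'
          (ν := freqMeasure s N)).measurable
    exact (h.norm.pow_const 4).ennreal_ofReal
  calc ∫⁻ x, ENNReal.ofReal (‖∫ ζ, osc x (σ x) ζ * g ζ‖ ^ 4)
      = ∫⁻ x, Filter.liminf (fun N : ℕ => ENNReal.ofReal
          (‖∫ ζ, osc x (σ x) ζ * reweight s g ζ ∂freqMeasure s N‖ ^ 4)) Filter.atTop :=
        lintegral_congr fun x => (hlim x).liminf_eq.symm
    _ ≤ Filter.liminf (fun N : ℕ => ∫⁻ x, ENNReal.ofReal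
          (‖∫ ζ, osc x (σ x) ζ * reweight s g ζ ∂freqMeasure s N‖ ^ 4)) Filter.atTop :=
        lintegral_liminf_le hmeas
    _ ≤ _ := Filter.liminf_le_of_le (by isBoundedDefault) fun b hb =>
        let ⟨N, hN⟩ := hb.exists
        hN.trans (htrunc N)

theorem exists_measurable_selector {Q : Type*} [MeasurableSpace Q] [Nonempty Q]
    {Φ : ℝ → Q → ENNReal} (hΦ : Measurable (Function.uncurry Φ)) (q : ℕ → Q) (n : ℕ) :
    ∃ σ : ℝ → Q, Measurable σ ∧ ∀ k ≤ n, ∀ x, Φ x (q k) ≤ Φ x (σ x) := by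
  classical
  induction n with
  | zero =>
    refine ⟨fun _ => q 0, measurable_const, fun k hk x => ?_⟩
    rw [Nat.le_zero.1 hk]
  | succ n ih =>
    obtain ⟨σ, hσ, hle⟩ := ih
    refine ⟨fun x => if Φ x (σ x) ≤ Φ x (q (n + 1)) then q (n + 1) else σ x,
      Measurable.ite (measurableSet_le (hΦ.comp (measurable_id.prodMk hσ))
        (hΦ.comp (measurable_id.prodMk measurable_const))) measurable_const hσ, fun k hk x => ?_⟩
    simp only
    rcases Nat.le_succ_iff.1 hk with hk | rfl
    · split_ifs with h
      · exact (hle k hk x).trans h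
      · exact hle k hk x
    · split_ifs with h
      · exact le_rfl
      · exact (not_le.1 h).le

theorem lintegral_iSup_le_of_forall_selector {Q : Type*} [TopologicalSpace Q]
    [TopologicalSpace.SeparableSpace Q] [Nonempty Q] [MeasurableSpace Q] [BorelSpace Q]
    {Φ : ℝ → Q → ENNReal} (hΦ : Measurable (Function.uncurry Φ)) (hc : ∀ x, Continuous (Φ x))
    {C : ENNReal} (h : ∀ σ : ℝ → Q, Measurable σ → ∫⁻ x, Φ x (σ x) ≤ C) :
    ∫⁻ x, ⨆ q, Φ x q ≤ C := by
  set d := TopologicalSpace.denseSeq Q with hd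
  have hsup : ∀ x, ⨆ q, Φ x q ≤ ⨆ n, partialSups (fun k => Φ x (d k)) n := by
    intro x
    rw [iSup_partialSups_eq]
    refine iSup_le fun q => ?_
    have hcl : IsClosed {q | Φ x q ≤ ⨆ k, Φ x (d k)} := isClosed_le (hc x) continuous_const
    have hsub : Set.range d ⊆ {q | Φ x q ≤ ⨆ k, Φ x (d k)} := by
      rintro _ ⟨k, rfl⟩
      exact le_iSup (fun k => Φ x (d k)) k
    exact hcl.closure_subset_iff.2 hsub (TopologicalSpace.denseRange_denseSeq Q q)
  have hm : ∀ k, Measurable fun x => Φ x (d k) := fun k =>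
    hΦ.comp (measurable_id.prodMk measurable_const)
  refine (lintegral_mono hsup).trans ?_
  rw [lintegral_iSup]
  · refine iSup_le fun n => ?_
    obtain ⟨σ, hσ, hle⟩ := exists_measurable_selector hΦ d n
    refine (lintegral_mono fun x => ?_).trans (h σ hσ)
    exact partialSups_le _ _ _ fun k hk => hle k hk x
  · intro n
    simp_rw [partialSups_eq_biSup]
    exact Measurable.iSup fun k => Measurable.iSup fun _ => hm k
  · exact fun m n hmn x => (partialSups fun k => Φ x (d k)).monotone hmn

theorem ofReal_iSup_pow_four {Q : Type*} [Nonempty Q] {u : Q → ℝ} (h0 : ∀ q, 0 ≤ u q)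
    (hb : BddAbove (Set.range u)) :
    ENNReal.ofReal ((⨆ q, u q) ^ 4) = ⨆ q, ENNReal.ofReal (u q ^ 4) := by
  have hmono : Monotone fun r : ℝ => ENNReal.ofReal (max r 0 ^ 4) := fun a b hab => by
    simp only
    gcongr
  have hcont : Continuous fun r : ℝ => ENNReal.ofReal (max r 0 ^ 4) :=
    ENNReal.continuous_ofReal.comp (by fun_prop)
  have := hmono.map_ciSup_of_continuousAt hcont.continuousAt hb
  simpa only [max_eq_left (h0 _), max_eq_left (Real.iSup_nonneg h0)] using this

theorem integral_iSup_pow_four_le {s : ℝ} (hs : 1 / 2 < s) {g : ℝ × ℝ → ℂ}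
    (hg : Measurable g) (hgi : Integrable g)
    (hg2 : Integrable fun ζ => (1 + ‖ζ‖ ^ 2) ^ (1 / 4 + s) * ‖g ζ‖ ^ 2) :
    ∫ x, (⨆ q, ‖∫ ζ, osc x q ζ * g ζ‖) ^ 4 ≤
      (14 * (4 * (1 + 11 * Real.pi) * ∫ η : ℝ, (1 + η ^ 2) ^ (-s)) *
        ∫ ζ, (1 + ‖ζ‖ ^ 2) ^ (1 / 4 + s) * ‖g ζ‖ ^ 2) ^ 2 := by
  set B := (14 * (4 * (1 + 11 * Real.pi) * ∫ η : ℝ, (1 + η ^ 2) ^ (-s)) *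
        ∫ ζ, (1 + ‖ζ‖ ^ 2) ^ (1 / 4 + s) * ‖g ζ‖ ^ 2) ^ 2 with hB
  have hB0 : 0 ≤ B := sq_nonneg _
  have hcont : Continuous fun p : ℝ × (ℝ × ℝ) => ∫ ζ, osc p.1 p.2 ζ * g ζ := by
    refine continuous_of_dominated (bound := fun ζ => ‖g ζ‖) (fun p => ?_)
      (fun p => Filter.Eventually.of_forall fun ζ => by rw [norm_mul, norm_osc, one_mul])
      hgi.norm (Filter.Eventually.of_forall fun ζ => ?_)
    · refine (Continuous.measurable ?_).mul hg |>.aestronglyMeasurable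
      exact continuous_osc.comp (by fun_prop : Continuous fun ζ : ℝ × ℝ => (p.1, p.2, ζ))
    · exact (continuous_osc.comp
        (by fun_prop : Continuous fun p : ℝ × (ℝ × ℝ) => (p.1, p.2, ζ))).mul continuous_const
  have hbdd : ∀ x, BddAbove (Set.range fun q => ‖∫ ζ, osc x q ζ * g ζ‖) := by
    intro x
    refine ⟨∫ ζ, ‖g ζ‖, ?_⟩
    rintro _ ⟨q, rfl⟩
    exact norm_integral_le_of_norm_le hgi.norm
      (Filter.Eventually.of_forall fun ζ => by rw [norm_mul, norm_osc, one_mul])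
  have hsel : ∀ σ : ℝ → ℝ × ℝ, Measurable σ →
      ∫⁻ x, ENNReal.ofReal (‖∫ ζ, osc x (σ x) ζ * g ζ‖ ^ 4) ≤ ENNReal.ofReal B :=
    fun σ hσ => lintegral_linearized_pow_four_le hs hg hgi hg2 hσ
  clear_value B
  have hlint : ∫⁻ x, ENNReal.ofReal ((⨆ q, ‖∫ ζ, osc x q ζ * g ζ‖) ^ 4) ≤ ENNReal.ofReal B := by
    generalize hF : (fun (x : ℝ) (q : ℝ × ℝ) => ‖∫ ζ, osc x q ζ * g ζ‖) = F
    have hF' : ∀ x q, ‖∫ ζ, osc x q ζ * g ζ‖ = F x q := fun x q => congrFun₂ hF x q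
    have hFc : Continuous (Function.uncurry F) := by
      rw [← hF]
      exact hcont.norm
    have hF0 : ∀ x q, 0 ≤ F x q := fun x q => hF' x q ▸ norm_nonneg _
    simp_rw [hF'] at hbdd hsel ⊢
    simp_rw [fun x => ofReal_iSup_pow_four (hF0 x) (hbdd x)]
    exact lintegral_iSup_le_of_forall_selector
      (Φ := fun x q => ENNReal.ofReal (F x q ^ 4))
      (hFc.measurable.pow_const 4).ennreal_ofReal
      (fun x => ENNReal.continuous_ofReal.comp ((hFc.uncurry_left x).pow 4)) hsel
  by_cases hi : Integrable fun x => (⨆ q, ‖∫ ζ, osc x q ζ * g ζ‖) ^ 4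
  · rw [← ofReal_integral_eq_lintegral_ofReal hi (Filter.Eventually.of_forall fun x => by
      simp only [Pi.zero_apply]; positivity)] at hlint
    exact (ENNReal.ofReal_le_ofReal_iff hB0).1 hlint
  · rw [integral_undef hi]
    exact hB0

theorem freeU_eq_integral_osc (f : ℝ × ℝ → ℂ) (x y t : ℝ) :
    freeU f x y t =
      ∫ ζ, osc x (y, t) ζ * (((((2 * Real.pi) ^ 2)⁻¹ : ℝ) : ℂ) * FT f ζ) := by
  rw [freeU, ← integral_const_mul]
  refine integral_congr_ae (Filter.Eventually.of_forall fun ζ => ?_)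
  simp only [osc]
  ring

/-- the `L⁴_x L^∞_{y,t}` maximal function estimate for the free evolution
of the linear symmetrized mZK equation: for every `ε ∈ (0,1)` there is `C = C(ε) > 0`
with `‖U(t)f‖_{L⁴_x L^∞_{y,t}} ≤ C ‖⟨D⟩^{3/4+ε} f‖_{L²(ℝ²)}` for all Schwartz `f`. -/
theorem maximal_in_yt_L4x :
    ∀ ε : ℝ, 0 < ε → ε < 1 →
      ∃ C : ℝ, 0 < C ∧
        ∀ f : SchwartzMap (ℝ × ℝ) ℂ,
          (∫ x : ℝ, (⨆ q : ℝ × ℝ, ‖freeU ⇑f x q.1 q.2‖) ^ 4) ^ ((1 : ℝ)/4)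
            ≤ C * Real.sqrt (∫ p : ℝ × ℝ, ‖JD ((3 : ℝ)/4 + ε) ⇑f p.1 p.2‖ ^ 2) := by
  intro ε hε _
  have hs : 1 / 2 < 1 / 2 + ε := by linarith
  have hexp : 1 / 4 + (1 / 2 + ε) = 3 / 4 + ε := by ring
  set A := ∫ η : ℝ, (1 + η ^ 2) ^ (-(1 / 2 + ε)) with hA
  have hA0 : 0 ≤ A := integral_nonneg fun η => by simp only [Pi.zero_apply]; positivity
  set c := ((2 * Real.pi) ^ 2)⁻¹ with hc
  have hc0 : 0 < c := by positivity
  set L := 14 * (4 * (1 + 11 * Real.pi) * A) * c with hL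
  have hL0 : 0 ≤ L := by positivity
  refine ⟨√L + 1, by positivity, fun f => ?_⟩
  obtain ⟨G, hG⟩ := exists_schwartz_eq_FT f
  obtain ⟨hJi, hJ⟩ := integral_norm_sq_JD f (3 / 4 + ε)
  set J := ∫ p : ℝ × ℝ, ‖JD (3 / 4 + ε) f p.1 p.2‖ ^ 2 with hJdef
  have hJ0 : 0 ≤ J := integral_nonneg fun p => by positivity
  have hnorm : ∀ ζ : ℝ × ℝ, (1 + ‖ζ‖ ^ 2) ^ (1 / 4 + (1 / 2 + ε)) * ‖(c : ℂ) * FT f ζ‖ ^ 2 =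
      c ^ 2 * ((1 + ‖ζ‖ ^ 2) ^ (3 / 4 + ε) * ‖FT f ζ‖ ^ 2) := by
    intro ζ
    rw [hexp, norm_mul, Complex.norm_real, Real.norm_of_nonneg hc0.le]
    ring
  have hFm : Measurable (FT f) := by rw [hG]; exact G.continuous.measurable
  have hFi : Integrable (FT f) := by rw [hG]; exact G.integrable
  have hmain := integral_iSup_pow_four_le hs (g := fun ζ => (c : ℂ) * FT f ζ)
    (hFm.const_mul _) (hFi.const_mul _) (by simp_rw [hnorm]; exact hJi.const_mul _)
  simp_rw [hnorm] at hmain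
  rw [integral_const_mul] at hmain
  have hbound : ∫ x : ℝ, (⨆ q : ℝ × ℝ, ‖freeU f x q.1 q.2‖) ^ 4 ≤ (L * J) ^ 2 := by
    simp_rw [freeU_eq_integral_osc]
    refine hmain.trans (le_of_eq ?_)
    rw [hJ, hL]
    ring
  have hI0 : 0 ≤ ∫ x : ℝ, (⨆ q : ℝ × ℝ, ‖freeU f x q.1 q.2‖) ^ 4 :=
    integral_nonneg fun x => by simp only [Pi.zero_apply]; positivity
  calc (∫ x : ℝ, (⨆ q : ℝ × ℝ, ‖freeU f x q.1 q.2‖) ^ 4) ^ ((1 : ℝ) / 4)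
      ≤ ((L * J) ^ 2) ^ ((1 : ℝ) / 4) := Real.rpow_le_rpow hI0 hbound (by norm_num)
    _ = √L * √J := by
        rw [← Real.sqrt_mul hL0, Real.sqrt_eq_rpow, ← Real.rpow_natCast (L * J) 2,
          ← Real.rpow_mul (by positivity)]
        norm_num
    _ ≤ (√L + 1) * √J := by gcongr; linarith
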